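/- arXiv:math/9803042 — 3 statements merged into one kernel-verified Lean document; each statement's English description precedes it below -/
import Mathlib

section
/- Let G be a group of nilpotency class at most 2 whose exponent is a squarefree positive integer n (a product of distinct primes). Then G is absolutely closed in N₂ if and only if the quotient group Z(G)/[G,G] is cyclic. -/
universe u

/-- A group is nilpotent of class at most 2 (lies in `N₂`) if its commutator
subgroup is contained in its center. -/
def IsNil2 (G : Type*) [Group G] : Prop :=
  commutator G ≤ Subgroup.center G

/-- The dominion of a subgroup `B` of `A` in the variety `N₂`: the set of `a ∈ A`
such that any two homomorphisms from `A` to a nil-2 group agreeing on `B` agree at `a`. -/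
def Dominion {A : Type u} [Group A] (B : Subgroup A) : Set A :=
  {a | ∀ (C : Type u) [Group C], IsNil2 C →
    ∀ f g : A →* C, (∀ b ∈ B, f b = g b) → f a = g a}

/-- A group `B` is absolutely closed in `N₂` if for every nil-2 group `A`
containing (a copy of) `B` as a subgroup, the dominion of `B` in `A` is `B`. -/
def IsAbsolutelyClosed (B : Type u) [Group B] : Prop :=
  ∀ (A : Type u) [Group A], IsNil2 A →
    ∀ ι : B →* A, Function.Injective ι →
      Dominion ι.range = (ι.range : Set A)




theorem circle_div {X : Type*} {Y : Type*} [AddCommGroup X] [AddCommGroup Y]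
    (f : X →+ Y) (g : X →+ UnitAddCircle) (h : ∀ x, f x = 0 → g x = 0) :
    ∃ k : Y →+ UnitAddCircle, ∀ x, k (f x) = g x := by
  have hb : Module.Baer ℤ UnitAddCircle := Module.Baer.of_divisible _
  have hle : f.ker ≤ g.ker := fun x hx => h x hx
  obtain ⟨k, hk⟩ := hb.extension_property_addMonoidHom (QuotientAddGroup.kerLift f)
    (QuotientAddGroup.kerLift_injective f) (QuotientAddGroup.lift f.ker g hle)
  refine ⟨k, fun x => ?_⟩
  have := DFunLike.congr_fun hk (x : X ⧸ f.ker)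
  simpa using this

theorem circle_tors {N : ℕ} [NeZero N] (t : UnitAddCircle) (h : N • t = 0) :
    ∃ j : ZMod N, ZMod.toAddCircle j = t := by
  have : Fact ((0:ℝ) < 1) := ⟨one_pos⟩
  obtain ⟨m, hm, rfl⟩ := (AddCircle.nsmul_eq_zero_iff (p := (1:ℝ)) (NeZero.pos N)).1 h
  exact ⟨m, by rw [ZMod.toAddCircle_natCast]; simp⟩

theorem circle_lift {N : ℕ} [NeZero N] {X : Type*} [AddCommGroup X]
    (f : X →+ UnitAddCircle) (h : ∀ x, N • f x = 0) :
    ∃ k : X →+ ZMod N, ∀ x, ZMod.toAddCircle (k x) = f x := by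
  choose k hk using fun x => circle_tors (f x) (h x)
  refine ⟨AddMonoidHom.mk' k fun a b => ?_, hk⟩
  apply ZMod.toAddCircle_injective N
  simp [hk]

theorem toAddCircle_tors {N : ℕ} [NeZero N] (j : ZMod N) : N • (ZMod.toAddCircle j) = 0 := by
  rw [← map_nsmul]; simp

/-- extension of a product pairing -/
theorem pairing_ext_prod {U : Type*} [AddCommGroup U] (W : AddSubgroup U) (p : ℕ) [Fact p.Prime]
    (lam : U ⧸ W →+ ZMod p) (eta : W →+ ZMod p)
    (H : ∀ k : ℕ, ∀ x : U ⧸ W, p ^ k • x = 0 → ∀ (w : W) (s : U), (w : U) = p ^ k • s →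
      lam x * eta w = 0) :
    ∃ b : U ⧸ W →+ U →+ UnitAddCircle,
      ∀ (x : U ⧸ W) (w : W), b x w = ZMod.toAddCircle (lam x * eta w) := by
  have hp : p.Prime := Fact.out
  by_cases hc : ∀ k : ℕ, ∀ x : U ⧸ W, p ^ k • x = 0 → lam x = 0
  · -- torsion is killed
    set X := U ⧸ W
    let Q := X ⧸ Submodule.torsion ℤ X
    have hle : Submodule.torsion ℤ X ≤ LinearMap.ker lam.toIntLinearMap := by
      intro x hx
      obtain ⟨a, ha⟩ := (Submodule.mem_torsion_iff x).1 hx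
      have ha0 : (a : ℤ) ≠ 0 := nonZeroDivisors.coe_ne_zero a
      have ha' : (a : ℤ).natAbs • x = 0 := by
        have h1 : (a : ℤ) • x = 0 := ha
        rcases Int.natAbs_eq (a : ℤ) with h | h
        · rw [h, natCast_zsmul] at h1; exact h1
        · rw [h, neg_smul, natCast_zsmul, neg_eq_zero] at h1; exact h1
      obtain ⟨k, m, hm, hkm⟩ := Nat.exists_eq_pow_mul_and_not_dvd
        (n := (a : ℤ).natAbs) (by simpa using ha0) p hp.ne_one
      have h2 : lam (m • x) = 0 := hc k _ (by rw [← mul_smul, ← hkm, ha'])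
      rw [map_nsmul, nsmul_eq_mul] at h2
      have h3 : (m : ZMod p) ≠ 0 := by rwa [Ne, ZMod.natCast_eq_zero_iff]
      exact (mul_eq_zero.1 h2).resolve_left h3
    let lamQ : Q →ₗ[ℤ] ZMod p := (Submodule.torsion ℤ X).liftQ lam.toIntLinearMap hle
    let Wm : Submodule ℤ U := W.toIntSubmodule
    let etaL : Wm →ₗ[ℤ] ZMod p := eta.toIntLinearMap
    have hinj := Module.Flat.lTensor_preserves_injective_linearMap (M := Q) Wm.subtype
      Wm.injective_subtype
    let g : TensorProduct ℤ Q Wm →ₗ[ℤ] ZMod p :=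
      TensorProduct.lift (((LinearMap.mul ℤ (ZMod p)).compl₁₂ lamQ etaL))
    obtain ⟨h, hh⟩ := circle_div (LinearMap.lTensor Q Wm.subtype).toAddMonoidHom
      ((ZMod.toAddCircle : ZMod p →+ _).comp g.toAddMonoidHom) (by
        intro x hx
        have : x = 0 := hinj (by simpa using hx)
        simp [this])
    let hL : TensorProduct ℤ Q U →ₗ[ℤ] UnitAddCircle := h.toIntLinearMap
    let b0 : Q →ₗ[ℤ] U →ₗ[ℤ] UnitAddCircle := TensorProduct.curry hL
    refine ⟨AddMonoidHom.mk' (fun x => (b0 (Submodule.Quotient.mk x)).toAddMonoidHom) ?_, ?_⟩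
    · intro x y; ext u; simp
    · intro x w
      exact hh (Submodule.Quotient.mk x ⊗ₜ[ℤ] (⟨w, w.2⟩ : Wm))
  · push Not at hc
    classical
    obtain ⟨k, hk⟩ : ∃ k : ℕ, (∀ x : U ⧸ W, p ^ k • x = 0 → lam x = 0) ∧
        ∃ x : U ⧸ W, p ^ (k+1) • x = 0 ∧ lam x ≠ 0 := by
      have h0 := Nat.find_spec hc
      rcases hK : Nat.find hc with _ | k
      · rw [hK] at h0
        obtain ⟨x, hx, hx'⟩ := h0
        simp at hx; simp [hx] at hx'
      · rw [hK] at h0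
        refine ⟨k, ?_, h0⟩
        have := Nat.find_min hc (m := k) (by omega)
        push Not at this
        exact this
    obtain ⟨hk1, x0, hx0, hx0'⟩ := hk
    have heta : ∀ (w : W) (s : U), (w : U) = p ^ (k+1) • s → eta w = 0 := fun w s h =>
      (mul_eq_zero.1 (H (k+1) x0 hx0 w s h)).resolve_left hx0'
    obtain ⟨mu, hmu⟩ := circle_div (nsmulAddMonoidHom (α := U ⧸ W) (p^k))
      ((ZMod.toAddCircle : ZMod p →+ _).comp lam) (by
        intro x hx
        simp [hk1 x (by simpa using hx)])
    have hmu' : ∀ x, p ^ k • mu x = ZMod.toAddCircle (lam x) := by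
      intro x; have := hmu x; simpa using this
    have hmut : ∀ x, p ^ (k+1) • mu x = 0 := by
      intro x; rw [pow_succ', mul_smul, hmu', toAddCircle_tors]
    let R : AddSubgroup U := (nsmulAddMonoidHom (α := U) (p^(k+1))).range
    obtain ⟨rho, hrho⟩ := circle_div ((QuotientAddGroup.mk' R).comp W.subtype)
      ((ZMod.toAddCircle : ZMod p →+ _).comp eta) (by
        intro w hw
        obtain ⟨s, hs⟩ := (QuotientAddGroup.eq_zero_iff _).1 hw
        simp [heta w s (by simpa using hs.symm)])
    have : NeZero (p^(k+1)) := ⟨pow_ne_zero _ hp.ne_zero⟩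
    obtain ⟨r, hr⟩ := circle_lift (N := p^(k+1)) (rho.comp (QuotientAddGroup.mk' R)) (by
      intro u
      rw [← map_nsmul]
      have : QuotientAddGroup.mk' R (p^(k+1) • u) = 0 :=
        (QuotientAddGroup.eq_zero_iff _).2 ⟨u, by simp⟩
      simp only [AddMonoidHom.comp_apply, this, map_zero])
    -- now the pairing
    let L : U ⧸ W → (ZMod (p^(k+1)) →+ UnitAddCircle) := fun x =>
      ZMod.lift (p^(k+1)) ⟨zmultiplesHom _ (mu x), (natCast_zsmul (mu x) (p^(k+1))).trans (hmut x)⟩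
    have hL : ∀ x (j : ℕ), L x (j : ZMod (p^(k+1))) = j • mu x := by
      intro x j
      have := ZMod.lift_coe (p^(k+1)) ⟨zmultiplesHom _ (mu x), (natCast_zsmul (mu x) (p^(k+1))).trans (hmut x)⟩ (j : ℤ)
      simpa [L] using this
    have hLadd : ∀ x y, L (x + y) = L x + L y := by
      intro x y
      ext j
      obtain ⟨j, rfl⟩ := ZMod.natCast_zmod_surjective j
      simp [hL]
    refine ⟨AddMonoidHom.mk' (fun x => (L x).comp r) ?_, ?_⟩
    · intro x y; ext u; simp [hLadd]
    · intro x w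
      show L x (r w) = _
      have h1 : r w = ((p^k * (eta w).val : ℕ) : ZMod (p^(k+1))) := by
        apply ZMod.toAddCircle_injective
        rw [hr, ZMod.toAddCircle_natCast]
        have := hrho w
        simp only [AddMonoidHom.comp_apply] at this ⊢
        erw [this]
        rw [ZMod.toAddCircle_apply]
        congr 1
        have : (p:ℝ) ≠ 0 := by exact_mod_cast hp.ne_zero
        push_cast
        field_simp
        ring
      rw [h1, hL, mul_comm, mul_smul, hmu', ← map_nsmul, nsmul_eq_mul]
      simp [mul_comm]

theorem vs_split {K X Y : Type*} [Field K] [AddCommGroup X] [AddCommGroup Y] [Module K X]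
    [Module K Y] (i : X →ₗ[K] Y)
    (hc : ∀ w1 w2, i w1 = 0 → i w2 = 0 → (∃ c : K, w1 = c • w2) ∨ ∃ c : K, w2 = c • w1) :
    ∃ (e : Y →ₗ[K] X) (w0 : X) (eta : X →ₗ[K] K), i w0 = 0 ∧
      ∀ w, w = e (i w) + eta w • w0 := by
  obtain ⟨s, hs⟩ := i.rangeRestrict.exists_rightInverse_of_surjective i.range_rangeRestrict
  obtain ⟨e, he⟩ := LinearMap.exists_extend s
  have hiei : ∀ w, i (e (i w)) = i w := by
    intro w
    have h1 : e (i w) = s (i.rangeRestrict w) := by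
      rw [← he]; rfl
    have h2 := LinearMap.congr_fun hs (i.rangeRestrict w)
    rw [h1]
    exact congrArg Subtype.val h2
  have hker : ∀ w, i (w - e (i w)) = 0 := fun w => by rw [map_sub, hiei, sub_self]
  by_cases hz : ∀ w, i w = 0 → w = 0
  · refine ⟨e, 0, 0, map_zero _, fun w => ?_⟩
    have := hz _ (hker w)
    rw [sub_eq_zero] at this
    simpa using this
  · push Not at hz
    obtain ⟨w0, hw0, hne⟩ := hz
    obtain ⟨f, hf⟩ := Module.Projective.exists_dual_eq_one K hne
    have hall : ∀ w, i w = 0 → ∃ c : K, w = c • w0 := by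
      intro w hw
      rcases hc w w0 hw hw0 with h | ⟨c, h⟩
      · exact h
      · have : c ≠ 0 := by rintro rfl; exact hne (by simpa using h)
        exact ⟨c⁻¹, by rw [h, smul_smul, inv_mul_cancel₀ this, one_smul]⟩
    refine ⟨e, w0, f ∘ₗ (LinearMap.id - e ∘ₗ i), hw0, fun w => ?_⟩
    obtain ⟨c, hcw⟩ := hall _ (hker w)
    have : (f ∘ₗ (LinearMap.id - e ∘ₗ i)) w = c := by
      show f (w - e (i w)) = c
      rw [hcw, map_smul, hf, smul_eq_mul, mul_one]
    rw [this, ← hcw]; abel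

theorem modN_mk_eq_zero {U : Type*} [AddCommGroup U] (p : ℕ) (x : U) :
    ModN.mkQ p x = 0 ↔ ∃ s, x = p • s := by
  show (LinearMap.range (LinearMap.lsmul ℤ U p)).mkQ x = 0 ↔ _
  rw [Submodule.mkQ_apply, Submodule.Quotient.mk_eq_zero]
  constructor
  · rintro ⟨s, hs⟩; exact ⟨s, by simpa using hs.symm⟩
  · rintro ⟨s, hs⟩; exact ⟨s, by simpa using hs.symm⟩

theorem modN_mk_surj {U : Type*} [AddCommGroup U] (p : ℕ) :
    Function.Surjective (ModN.mkQ p : U →+ ModN U p) :=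
  Submodule.mkQ_surjective _

theorem modN_lift {U : Type*} {H : Type*} [AddCommGroup U] (p : ℕ) [AddCommGroup H]
    [Module (ZMod p) H] (f : U →+ H) : ∃ g : ModN U p →ₗ[ZMod p] H, ∀ x, g (ModN.mkQ p x) = f x := by
  refine ⟨ModN.liftEquiv'.symm ⟨f, fun x => ?_⟩, fun x => ?_⟩
  · rw [← Nat.cast_smul_eq_nsmul (ZMod p)]; simp
  · rfl

theorem pairing_ext {U : Type*} [AddCommGroup U] (W : AddSubgroup U) (p : ℕ) [Fact p.Prime]
    (P : U →+ W →+ ZMod p) (h0 : ∀ w w' : W, P w w' = 0)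
    (ha : ∀ w1 w2 : W, (∃ s, (w1 : U) = p • s) → (∃ s, (w2 : U) = p • s) →
      ∃ j : ℤ, (∃ w3 : W, w1 - j • w2 = p • w3) ∨ ∃ w3 : W, w2 - j • w1 = p • w3)
    (hb : ∀ k : ℕ, 1 ≤ k → ∀ x : U, p ^ k • x ∈ W → ∀ (w : W) (s : U), (w : U) = p ^ k • s →
      P x w = 0) :
    ∃ b : U →+ U →+ UnitAddCircle, (∀ w ∈ W, ∀ u, b w u = 0) ∧
      ∀ (u : U) (w : W), b u w = ZMod.toAddCircle (P u w) := by
  obtain ⟨i, hi⟩ := modN_lift p ((ModN.mkQ p).comp W.subtype)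
  replace hi : ∀ w : W, i (ModN.mkQ p w) = ModN.mkQ p (w : U) := hi
  have key : ∀ (w1 w2 : W) (j : ℤ), (∃ w3 : W, w1 - j • w2 = p • w3) →
      ModN.mkQ p w1 = (j : ZMod p) • ModN.mkQ p w2 := by
    intro w1 w2 j h
    have := (modN_mk_eq_zero p _).2 h
    rw [map_sub, map_zsmul, sub_eq_zero] at this
    rw [this, Int.cast_smul_eq_zsmul]
  obtain ⟨e, w0b, eta, hw0, hsplit⟩ := vs_split i (by
    intro w1 w2 h1 h2
    obtain ⟨w1, rfl⟩ := modN_mk_surj p w1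
    obtain ⟨w2, rfl⟩ := modN_mk_surj p w2
    rw [hi, modN_mk_eq_zero] at h1 h2
    obtain ⟨j, h | h⟩ := ha w1 w2 h1 h2
    · exact Or.inl ⟨j, key _ _ _ h⟩
    · exact Or.inr ⟨j, key _ _ _ h⟩)
  obtain ⟨w0, rfl⟩ := modN_mk_surj p w0b
  choose Pb hPb using fun u => modN_lift p (P u)
  have hPbadd : ∀ x y, Pb (x + y) = Pb x + Pb y := by
    intro x y
    refine LinearMap.ext fun z => ?_
    obtain ⟨z, rfl⟩ := modN_mk_surj p z
    rw [LinearMap.add_apply, hPb, hPb, hPb, map_add, AddMonoidHom.add_apply]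
  let P0 : U →+ ZMod p := AddMonoidHom.mk' (fun u => P u w0) (by intro a b; simp)
  let lam : U ⧸ W →+ ZMod p := QuotientAddGroup.lift W P0 (fun w hw => h0 ⟨w, hw⟩ w0)
  have hlam : ∀ u : U, lam (u : U ⧸ W) = P u w0 := fun u => rfl
  let et : W →+ ZMod p := eta.toAddMonoidHom.comp (ModN.mkQ p)
  have het : ∀ w, et w = eta (ModN.mkQ p w) := fun w => rfl
  have hexp : ∀ u w, P u w = Pb u (e (ModN.mkQ p (w : U))) + P u w0 * et w := by
    intro u w
    rw [← hPb, ← hPb]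
    conv_lhs => rw [hsplit (ModN.mkQ p w), hi]
    rw [map_add, map_smul, smul_eq_mul, het, mul_comm]
  obtain ⟨b, hbb⟩ := pairing_ext_prod W p lam et (by
    intro k x hx w s hs
    obtain ⟨u, rfl⟩ := QuotientAddGroup.mk_surjective x
    rcases Nat.eq_zero_or_pos k with rfl | hk
    · rw [pow_zero, one_smul] at hx
      rw [hx, map_zero, zero_mul]
    · have h1 : p ^ k • u ∈ W := (QuotientAddGroup.eq_zero_iff _).1 hx
      have h2 := hb k hk u h1 w s hs
      have h3 : ModN.mkQ p (w : U) = 0 := by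
        rw [modN_mk_eq_zero]
        refine ⟨p ^ (k-1) • s, ?_⟩
        rw [hs, ← mul_smul, ← pow_succ']
        congr 2; omega
      rw [hexp, h3, map_zero, map_zero, zero_add] at h2
      rw [hlam, h2])
  refine ⟨AddMonoidHom.mk' (fun u => (ZMod.toAddCircle : ZMod p →+ _).comp
    (((Pb u).toAddMonoidHom.comp e.toAddMonoidHom).comp (ModN.mkQ p)) + b (u : U ⧸ W)) ?_, ?_, ?_⟩
  · intro x y
    ext z
    simp [hPbadd]
    abel
  · intro w hw u
    have h1 : (w : U ⧸ W) = 0 := (QuotientAddGroup.eq_zero_iff _).2 hw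
    have h2 : ∀ z, Pb w z = 0 := by
      intro z
      obtain ⟨z, rfl⟩ := modN_mk_surj p z
      rw [hPb]; exact h0 ⟨w, hw⟩ z
    simp [h1, h2]
  · intro u w
    have := hbb u w
    rw [hlam] at this
    rw [hexp u w, map_add, ← this]
    rfl
section Main
open scoped commutatorElement IsMulCommutative


theorem add_key {U Z : Type*} [AddCommGroup U] [AddCommGroup Z] (κ : U →+ U →+ Z)
    (halt : ∀ u, κ u u = 0) (W : AddSubgroup U) (p m : ℕ) [Fact p.Prime] (hpm : Nat.Coprime p m)
    (hW : ∀ w ∈ W, (p * m) • w = 0)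
    (hc : ∀ v1 ∈ W, ∀ v2 ∈ W, (∀ w ∈ W, κ (m • v1) w = 0) → (∀ w ∈ W, κ (m • v2) w = 0) →
      ∃ j : ℤ, m • v1 = j • (m • v2) ∨ m • v2 = j • (m • v1))
    (χ : Z →+ UnitAddCircle) (hχ : ∀ w ∈ W, ∀ w' ∈ W, χ (κ w w') = 0)
    (hχp : ∀ u, ∀ w ∈ W, p • χ (κ u w) = 0) :
    ∃ b : U →+ U →+ UnitAddCircle, (∀ w ∈ W, ∀ u, b w u = 0) ∧
      ∀ u, ∀ w ∈ W, b u w = χ (κ u w) := by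
  have hp : p.Prime := Fact.out
  choose P0 hP0 using fun (u : U) (w : W) => circle_tors (N := p) (χ (κ u w)) (hχp u w w.2)
  let P : U →+ W →+ ZMod p := AddMonoidHom.mk' (fun u => AddMonoidHom.mk' (P0 u) (by
      intro w w'
      apply ZMod.toAddCircle_injective p
      simp [hP0])) (by
      intro u u'
      refine AddMonoidHom.ext fun w => ?_
      apply ZMod.toAddCircle_injective p
      simp [hP0])
  have hP : ∀ u w, ZMod.toAddCircle (P u w) = χ (κ u w) := hP0
  have hcen : ∀ k : ℕ, 1 ≤ k → ∀ v s : U, v = p ^ k • s → ∀ w ∈ W, κ (m • v) w = 0 := by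
    intro k hk v s hv w hw
    obtain ⟨k, rfl⟩ : ∃ l, k = l + 1 := ⟨k - 1, by omega⟩
    rw [hv, map_nsmul, map_nsmul, AddMonoidHom.nsmul_apply, AddMonoidHom.nsmul_apply, ← map_nsmul,
      ← map_nsmul, ← mul_smul]
    have : m * p ^ (k+1) = p ^ k * (p * m) := by ring
    rw [this, mul_smul, hW w hw, smul_zero, map_zero]
  have hdiv : ∀ w1 ∈ W, ∀ w2 ∈ W, ∀ j : ℤ, m • w1 = j • (m • w2) →
      ∃ w3 ∈ W, w1 - j • w2 = p • w3 := by
    intro w1 h1 w2 h2 j h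
    have hm : (m : ℤ) • (w1 - j • w2) = 0 := by
      rw [natCast_zsmul, smul_sub, h, smul_comm, sub_self]
    obtain ⟨α, β, hαβ⟩ : ∃ α β : ℤ, (p : ℤ) * α + m * β = 1 := by
      refine ⟨Nat.gcdA p m, Nat.gcdB p m, ?_⟩
      rw [← Nat.gcd_eq_gcd_ab]; exact_mod_cast hpm
    refine ⟨α • (w1 - j • w2), W.zsmul_mem (W.sub_mem h1 (W.zsmul_mem h2 j)) α, ?_⟩
    rw [← natCast_zsmul, ← mul_smul]
    conv_lhs => rw [← one_smul ℤ (w1 - j • w2), ← hαβ, add_smul, mul_comm (m : ℤ), mul_smul β, hm,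
      smul_zero, add_zero]
  obtain ⟨b, hb1, hb2⟩ := pairing_ext W p P (by
      intro w w'
      apply ZMod.toAddCircle_injective p
      rw [hP, map_zero, hχ w w.2 w' w'.2]) (by
      rintro w1 w2 ⟨s1, hs1⟩ ⟨s2, hs2⟩
      obtain ⟨j, h | h⟩ := hc w1 w1.2 w2 w2.2 (hcen 1 le_rfl _ s1 (by simpa using hs1))
        (hcen 1 le_rfl _ s2 (by simpa using hs2))
      · obtain ⟨w3, hw3, h3⟩ := hdiv _ w1.2 _ w2.2 j h
        exact ⟨j, Or.inl ⟨⟨w3, hw3⟩, Subtype.ext h3⟩⟩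
      · obtain ⟨w3, hw3, h3⟩ := hdiv _ w2.2 _ w1.2 j h
        exact ⟨j, Or.inr ⟨⟨w3, hw3⟩, Subtype.ext h3⟩⟩) (by
      intro k hk x hx w s hs
      have hkey : m • κ x w = 0 := by
        obtain ⟨j, h | h⟩ := hc _ hx _ w.2 (hcen k hk _ x rfl) (hcen k hk _ s hs)
        · have e1 : m • κ x w = κ (m • p ^ k • x) s := by
            rw [hs]; simp only [map_nsmul, AddMonoidHom.nsmul_apply]
          rw [e1, h, hs]
          simp only [map_nsmul, map_zsmul, AddMonoidHom.nsmul_apply, AddMonoidHom.zsmul_apply, halt,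
            smul_zero]
        · rw [← map_nsmul, h]
          simp only [map_nsmul, map_zsmul, halt, smul_zero]
      have h1 : (m : ZMod p) * P x w = 0 := by
        apply ZMod.toAddCircle_injective p
        rw [← nsmul_eq_mul, map_nsmul, hP, ← map_nsmul, hkey, map_zero, map_zero]
      refine (mul_eq_zero.1 h1).resolve_left ?_
      rw [ZMod.natCast_eq_zero_iff]
      intro hd
      exact hp.one_lt.ne' (Nat.eq_one_of_dvd_coprimes hpm dvd_rfl hd))
  exact ⟨b, hb1, fun u w hw => by rw [← hP u ⟨w, hw⟩]; exact hb2 u ⟨w, hw⟩⟩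

/-! ### nil-2 basics -/

theorem IsNil2.comm_mem {A : Type*} [Group A] (h : IsNil2 A) (x y : A) :
    ⁅x, y⁆ ∈ Subgroup.center A :=
  h (Subgroup.commutator_mem_commutator (Subgroup.mem_top x) (Subgroup.mem_top y))

theorem isNil2_of {A : Type*} [Group A] (h : ∀ x y z : A, z * ⁅x, y⁆ = ⁅x, y⁆ * z) : IsNil2 A := by
  unfold IsNil2
  rw [commutator_def, Subgroup.commutator_le]
  intro x _ y _
  rw [Subgroup.mem_center_iff]
  exact h x y

/-- The commutator map of a nil-2 group. -/
def cm {A : Type*} [Group A] (h : IsNil2 A) : A →* A →* Subgroup.center A :=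
  MonoidHom.mk' (fun x => MonoidHom.mk' (fun y => ⟨⁅x, y⁆, h.comm_mem x y⟩) (by
      intro y z
      apply Subtype.ext
      have := Subgroup.mem_center_iff.1 (h.comm_mem x z) y⁻¹
      show ⁅x, y * z⁆ = ⁅x, y⁆ * ⁅x, z⁆
      calc ⁅x, y * z⁆ = x * y * x⁻¹ * (⁅x, z⁆ * y⁻¹) := by
            simp only [commutatorElement_def]; group
        _ = ⁅x, y⁆ * ⁅x, z⁆ := by rw [← this]; simp only [commutatorElement_def]; group)) (by
      intro x y
      refine MonoidHom.ext fun z => Subtype.ext ?_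
      have := Subgroup.mem_center_iff.1 (h.comm_mem y z) x
      have h2 := Subgroup.mem_center_iff.1 (h.comm_mem y z) ⁅x, z⁆
      show ⁅x * y, z⁆ = ⁅x, z⁆ * ⁅y, z⁆
      calc ⁅x * y, z⁆ = x * ⁅y, z⁆ * (z * x⁻¹ * z⁻¹) := by
            simp only [commutatorElement_def]; group
        _ = ⁅y, z⁆ * ⁅x, z⁆ := by rw [this, commutatorElement_def x z]; group
        _ = ⁅x, z⁆ * ⁅y, z⁆ := h2.symm)

theorem cm_coe {A : Type*} [Group A] (h : IsNil2 A) (x y : A) : (cm h x y : A) = ⁅x, y⁆ := rfl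

/-- Commutator pairing on the abelianization. -/
noncomputable def cmU {A : Type*} [Group A] (h : IsNil2 A) :
    Abelianization A →* Abelianization A →* Subgroup.center A :=
  Abelianization.lift (MonoidHom.mk' (fun x => Abelianization.lift (cm h x)) (by
    intro x y
    ext z
    simp))

theorem cmU_coe {A : Type*} [Group A] (h : IsNil2 A) (x y : A) :
    (cmU h (Abelianization.of x) (Abelianization.of y) : A) = ⁅x, y⁆ := rfl

/-! ### central extensions by bilinear cocycles -/

@[ext] structure CExt {H M : Type*} [Group H] [CommGroup M] (β : H →* H →* M) where
  fst : H
  snd : M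

namespace CExt
variable {H M : Type*} [Group H] [CommGroup M] {β : H →* H →* M}

instance : Mul (CExt β) := ⟨fun a b => ⟨a.fst * b.fst, a.snd * b.snd * β a.fst b.fst⟩⟩
instance : One (CExt β) := ⟨⟨1, 1⟩⟩
instance : Inv (CExt β) := ⟨fun a => ⟨a.fst⁻¹, a.snd⁻¹ * β a.fst a.fst⟩⟩

theorem mul_fst (a b : CExt β) : (a * b).fst = a.fst * b.fst := rfl
theorem mul_snd (a b : CExt β) : (a * b).snd = a.snd * b.snd * β a.fst b.fst := rfl
theorem one_fst : (1 : CExt β).fst = 1 := rfl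
theorem one_snd : (1 : CExt β).snd = 1 := rfl
theorem inv_fst (a : CExt β) : (a⁻¹).fst = a.fst⁻¹ := rfl
theorem inv_snd (a : CExt β) : (a⁻¹).snd = a.snd⁻¹ * β a.fst a.fst := rfl

instance : Group (CExt β) := Group.ofLeftAxioms
  (by
    intro a b c
    ext
    · simp only [mul_fst, mul_assoc]
    · simp only [mul_fst, mul_snd, map_mul, MonoidHom.mul_apply]
      simp only [mul_assoc, mul_left_comm, mul_comm])
  (by
    intro a
    ext
    · simp [mul_fst, one_fst]
    · simp [mul_snd, one_snd, one_fst])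
  (by
    intro a
    ext
    · simp [mul_fst, one_fst, inv_fst]
    · simp [mul_snd, one_snd, inv_fst, inv_snd])

/-- projection -/
def proj (β : H →* H →* M) : CExt β →* H := MonoidHom.mk' CExt.fst (fun _ _ => rfl)

theorem isNil2 (hH : IsNil2 H) : IsNil2 (CExt β) := by
  apply isNil2_of
  intro x y z
  have hf : (⁅x, y⁆ : CExt β).fst = ⁅x.fst, y.fst⁆ := map_commutatorElement (proj β) x y
  have h1 : β ⁅x.fst, y.fst⁆ = 1 := by
    rw [map_commutatorElement, commutatorElement_eq_one_iff_mul_comm, mul_comm]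
  have h2 : ∀ w, β w ⁅x.fst, y.fst⁆ = 1 := by
    intro w
    rw [map_commutatorElement, commutatorElement_eq_one_iff_mul_comm, mul_comm]
  ext
  · rw [mul_fst, mul_fst, hf]
    exact Subgroup.mem_center_iff.1 (hH.comm_mem _ _) _
  · rw [mul_snd, mul_snd, hf, h1, h2]
    simp [mul_comm]

end CExt

theorem cmU_of_mem {A : Type*} [Group A] {x : A} : x ∈ commutator A ↔ Abelianization.of x = 1 := by
  rw [← MonoidHom.mem_ker, Abelianization.ker_of]

/-- Separation: given the pairing, build a nil-2 group in which `z` is separated. -/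
theorem separate {A : Type u} [Group A] (hA : IsNil2 A) (B : Subgroup A)
    (χ : Additive (Subgroup.center A) →+ UnitAddCircle)
    (hχB : ∀ z : Subgroup.center A, (z : A) ∈ B → χ (Additive.ofMul z) = 0)
    (b : Additive (Abelianization A) →+ Additive (Abelianization A) →+ UnitAddCircle)
    (hb1 : ∀ g ∈ B, ∀ u, b (Additive.ofMul (Abelianization.of g)) u = 0)
    (hb2 : ∀ y : A, ∀ g ∈ B, b (Additive.ofMul (Abelianization.of y))
      (Additive.ofMul (Abelianization.of g)) = χ (Additive.ofMul (cm hA y g)))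
    (z : A) (hz : z ∈ commutator A) (hχz : χ (Additive.ofMul ⟨z, hA hz⟩) ≠ 0) :
    ∃ (C : Type u) (_ : Group C), IsNil2 C ∧ ∃ f g : A →* C, (∀ x ∈ B, f x = g x) ∧ f z ≠ g z := by
  let q : A → Additive (Abelianization A) := fun x => Additive.ofMul (Abelianization.of x)
  have hq1 : q 1 = 0 := by simp [q]
  have hqm : ∀ x y, q (x * y) = q x + q y := by intro x y; simp [q]
  have hqc : ∀ x ∈ commutator A, q x = 0 := by
    intro x hx; simp [q, cmU_of_mem.1 hx]
  let β : A × A →* A × A →* Multiplicative UnitAddCircle :=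
    MonoidHom.mk' (fun s => MonoidHom.mk' (fun r =>
      Multiplicative.ofAdd (b (q s.2) (q r.2 - q r.1))) (by
        intro r r'
        rw [← ofAdd_add, ← map_add, Prod.fst_mul, Prod.snd_mul, hqm, hqm]
        congr 2; abel)) (by
        intro s s'
        refine MonoidHom.ext fun r => ?_
        show Multiplicative.ofAdd (b (q (s * s').2) (q r.2 - q r.1)) =
          Multiplicative.ofAdd (b (q s.2) (q r.2 - q r.1)) *
            Multiplicative.ofAdd (b (q s'.2) (q r.2 - q r.1))
        rw [← ofAdd_add, Prod.snd_mul, hqm, map_add]; rfl)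
  have hβ : ∀ s r : A × A, β s r = Multiplicative.ofAdd (b (q s.2) (q r.2 - q r.1)) :=
    fun _ _ => rfl
  have hAA : IsNil2 (A × A) := by
    apply isNil2_of
    rintro ⟨x1, x2⟩ ⟨y1, y2⟩ ⟨z1, z2⟩
    exact Prod.ext (Subgroup.mem_center_iff.1 (hA.comm_mem x1 y1) z1)
      (Subgroup.mem_center_iff.1 (hA.comm_mem x2 y2) z2)
  have hbB : ∀ g ∈ B, ∀ c ∈ commutator A, ∀ u, b (q (g * c)) u = 0 := by
    intro g hg c hc u
    rw [hqm, hqc c hc, add_zero]; exact hb1 g hg u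
  have hcen : ∀ c ∈ commutator A, ∀ x, x * c = c * x := fun c hc x =>
    Subgroup.mem_center_iff.1 (hA hc) x
  let ch : commutator A →* Multiplicative UnitAddCircle :=
    (AddMonoidHom.toMultiplicativeRight χ).comp (Subgroup.inclusion hA)
  have hch : ∀ c : commutator A, ch c = Multiplicative.ofAdd (χ (Additive.ofMul ⟨c, hA c.2⟩)) :=
    fun _ => rfl
  let N : Subgroup (CExt β) :=
    { carrier := {e | e.fst.1 = 1 ∧ ∃ g ∈ B, ∃ c : commutator A, e.fst.2 = g * c ∧ e.snd = ch c}
      one_mem' := ⟨rfl, 1, B.one_mem, 1, by simp [CExt.one_fst], by simp [CExt.one_snd]⟩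
      mul_mem' := by
        rintro e e' ⟨h1, g, hg, c, hgc, hs⟩ ⟨h1', g', hg', c', hgc', hs'⟩
        refine ⟨by rw [CExt.mul_fst, Prod.fst_mul, h1, h1', one_mul], g * g', B.mul_mem hg hg',
          c * c', ?_, ?_⟩
        · rw [CExt.mul_fst, Prod.snd_mul, hgc, hgc', Subgroup.coe_mul]
          have := hcen c c.2 g'
          calc g * c * (g' * c') = g * (c * g') * c' := by group
            _ = _ := by rw [← this]; group
        · rw [CExt.mul_snd, hs, hs', map_mul, hβ, hgc, hbB g hg c c.2]; simp
      inv_mem' := by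
        rintro e ⟨h1, g, hg, c, hgc, hs⟩
        refine ⟨by rw [CExt.inv_fst, Prod.fst_inv, h1, inv_one], g⁻¹, B.inv_mem hg, c⁻¹, ?_, ?_⟩
        · rw [CExt.inv_fst, Prod.snd_inv, hgc, mul_inv_rev, Subgroup.coe_inv]
          exact (hcen _ ((commutator A).inv_mem c.2) _).symm
        · rw [CExt.inv_snd, hs, map_inv, hβ, hgc, hbB g hg c c.2]; simp }
  have hNn : N.Normal := by
    constructor
    rintro e ⟨h1, g, hg, c, hgc, hs⟩ a
    let d : commutator A := ⟨⁅a.fst.2, g⁆,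
      Subgroup.commutator_mem_commutator (Subgroup.mem_top _) (Subgroup.mem_top _)⟩
    let e' : CExt β := ⟨(1, g * (c * d : commutator A)), ch (c * d)⟩
    have he' : e' ∈ N := ⟨rfl, g, hg, c * d, rfl, rfl⟩
    have : a * e = e' * a := by
      have hd := hcen d d.2 g
      have hcc := hcen c c.2
      have hdd : (d : A) * g * a.fst.2 = a.fst.2 * g := by
        simp [d, commutatorElement_def]
      ext
      · simp [CExt.mul_fst, e', h1]
      · show a.fst.2 * e.fst.2 = g * (c * d) * a.fst.2
        rw [hgc]
        calc a.fst.2 * (g * c) = (a.fst.2 * g) * c := by group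
          _ = c * (a.fst.2 * g) := hcc _
          _ = c * (d * g * a.fst.2) := by rw [hdd]
          _ = c * (g * d) * a.fst.2 := by rw [hd]; group
          _ = (c * g) * d * a.fst.2 := by group
          _ = g * (c * d) * a.fst.2 := by rw [← hcc g]; group
      · rw [CExt.mul_snd, CExt.mul_snd, hs]
        have e1 : β e'.fst a.fst = 1 := by
          rw [hβ]
          show Multiplicative.ofAdd (b (q (g * (c * d : commutator A))) _) = 1
          rw [hbB g hg _ (c * d).2]; rfl
        have e2 : β a.fst e.fst = ch d := by
          rw [hβ, hch, hgc, h1, hq1, sub_zero, hqm, hqc c c.2, add_zero]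
          exact congrArg Multiplicative.ofAdd (hb2 a.fst.2 g hg)
        rw [e1, e2]
        show a.snd * ch c * ch d = ch (c * d) * a.snd * 1
        rw [map_mul, mul_one, mul_assoc, mul_comm]
    have h2 : a * e * a⁻¹ = e' := by rw [this, mul_inv_cancel_right]
    rw [h2]; exact he'
  have hC : IsNil2 (CExt β ⧸ N) := by
    apply isNil2_of
    intro x y w
    obtain ⟨x, rfl⟩ := QuotientGroup.mk_surjective x
    obtain ⟨y, rfl⟩ := QuotientGroup.mk_surjective y
    obtain ⟨w, rfl⟩ := QuotientGroup.mk_surjective w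
    have := Subgroup.mem_center_iff.1 ((CExt.isNil2 (β := β) hAA).comm_mem x y) w
    exact congrArg (QuotientGroup.mk' N) this
  let f0 : A →* CExt β := MonoidHom.mk' (fun x => ⟨(x, 1), 1⟩) (by
    intro x y
    ext
    · rfl
    · simp [CExt.mul_fst]
    · rw [CExt.mul_snd, hβ]; simp [hq1])
  let g0 : A →* CExt β := MonoidHom.mk' (fun x => ⟨(x, x), 1⟩) (by
    intro x y
    ext
    · rfl
    · rfl
    · rw [CExt.mul_snd, hβ]; simp)
  have hfg : ∀ x, (f0 x)⁻¹ * g0 x = ⟨(1, x), 1⟩ := by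
    intro x
    rw [inv_mul_eq_iff_eq_mul]
    ext
    · simp [CExt.mul_fst, f0, g0]
    · simp [CExt.mul_fst, f0, g0]
    · rw [CExt.mul_snd, hβ]; simp [f0, g0, hq1]
  refine ⟨CExt β ⧸ N, inferInstance, hC, (QuotientGroup.mk' N).comp f0,
    (QuotientGroup.mk' N).comp g0, ?_, ?_⟩
  · intro x hx
    refine (QuotientGroup.eq (s := N)).2 ?_
    rw [hfg]
    exact ⟨rfl, x, hx, 1, by simp, by simp⟩
  · intro h
    have h' : (f0 z)⁻¹ * g0 z ∈ N := (QuotientGroup.eq (s := N)).1 h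
    rw [hfg] at h'
    obtain ⟨-, g, hg, c, hgc, hs⟩ := h'
    apply hχz
    have hgc' : z = g * c := hgc
    have hgZ : g ∈ Subgroup.center A := by
      have : g = z * (c : A)⁻¹ := by rw [hgc']; group
      rw [this]
      exact Subgroup.mul_mem _ (hA hz) (Subgroup.inv_mem _ (hA c.2))
    have h1 : (⟨z, hA hz⟩ : Subgroup.center A) = ⟨g, hgZ⟩ * ⟨c, hA c.2⟩ := Subtype.ext hgc'
    rw [h1, ofMul_mul, map_add, hχB ⟨g, hgZ⟩ hg, zero_add]
    have h2 : (1 : Multiplicative UnitAddCircle) = ch c := hs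
    rw [hch] at h2
    exact (congrArg Multiplicative.toAdd h2).symm

theorem dominion_step1 {A : Type u} [Group A] (hA : IsNil2 A) (B : Subgroup A) (n : ℕ)
    (hB : ∀ g ∈ B, g ^ n = 1) (a : A) (ha : a ∈ Dominion B) :
    ∃ g ∈ B, ∃ z ∈ commutator A, z ^ n = 1 ∧ a = g * z := by
  have hcen : ∀ c ∈ commutator A, ∀ x, x * c = c * x := fun c hc x =>
    Subgroup.mem_center_iff.1 (hA hc) x
  let S : Subgroup A :=
    { carrier := {a | ∃ g ∈ B, ∃ z ∈ commutator A, z ^ n = 1 ∧ a = g * z}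
      one_mem' := ⟨1, B.one_mem, 1, Subgroup.one_mem _, one_pow n, by simp⟩
      mul_mem' := by
        rintro _ _ ⟨g, hg, z, hz, hzn, rfl⟩ ⟨g', hg', z', hz', hzn', rfl⟩
        refine ⟨g * g', B.mul_mem hg hg', z * z', Subgroup.mul_mem _ hz hz', ?_, ?_⟩
        · rw [Commute.mul_pow (hcen z' hz' z), hzn, hzn', one_mul]
        · calc g * z * (g' * z') = g * (z * g') * z' := by group
            _ = _ := by rw [← hcen z hz]; group
      inv_mem' := by
        rintro _ ⟨g, hg, z, hz, hzn, rfl⟩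
        refine ⟨g⁻¹, B.inv_mem hg, z⁻¹, Subgroup.inv_mem _ hz, by rw [inv_pow, hzn, inv_one], ?_⟩
        rw [mul_inv_rev, hcen _ (Subgroup.inv_mem _ hz)] }
  have hS : S.Normal := by
    constructor
    rintro _ ⟨g, hg, z, hz, hzn, rfl⟩ y
    have hd : ⁅y, g⁆ ∈ commutator A :=
      Subgroup.commutator_mem_commutator (Subgroup.mem_top _) (Subgroup.mem_top _)
    refine ⟨g, hg, ⁅y, g⁆ * z, Subgroup.mul_mem _ hd hz, ?_, ?_⟩
    · rw [Commute.mul_pow (hcen z hz _), hzn, mul_one]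
      have : (cm hA y (g ^ n) : A) = ⁅y, g⁆ ^ n := by rw [map_pow]; rfl
      rw [← this, hB g hg, map_one]; rfl
    · calc y * (g * z) * y⁻¹ = y * g * (z * y⁻¹) := by group
        _ = (y * g * y⁻¹) * z := by rw [← hcen z hz]; group
        _ = (⁅y, g⁆ * g) * z := by rw [commutatorElement_def]; group
        _ = _ := by rw [← hcen _ hd]; group
  have hC : IsNil2 (A ⧸ S) := by
    apply isNil2_of
    intro x y w
    obtain ⟨x, rfl⟩ := QuotientGroup.mk_surjective x
    obtain ⟨y, rfl⟩ := QuotientGroup.mk_surjective y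
    obtain ⟨w, rfl⟩ := QuotientGroup.mk_surjective w
    have := Subgroup.mem_center_iff.1 (hA.comm_mem x y) w
    exact congrArg (QuotientGroup.mk' S) this
  have h := ha (A ⧸ S) hC (QuotientGroup.mk' S) 1 (by
    intro b hb
    rw [MonoidHom.one_apply]
    exact (QuotientGroup.eq_one_iff b).2
      ⟨b, hb, 1, Subgroup.one_mem _, one_pow n, by simp⟩)
  exact (QuotientGroup.eq_one_iff a).1 h

theorem exists_char {Y : Type*} [AddCommGroup Y] (p : ℕ) [Fact p.Prime] (y : Y) (hy : y ≠ 0)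
    (hpy : p • y = 0) : ∃ k : Y →+ UnitAddCircle, k y ≠ 0 := by
  have hp : p.Prime := Fact.out
  let f : ZMod p →+ Y := ZMod.lift p ⟨zmultiplesHom Y y, by simpa using hpy⟩
  have hf1 : f 1 = y := by
    have := ZMod.lift_castAddHom p ⟨zmultiplesHom Y y, by simpa using hpy⟩ 1
    simpa [f] using this
  have hinj : ∀ x, f x = 0 → x = 0 := by
    intro x hx
    by_contra hx0
    apply hy
    have h1 : (x⁻¹).val • x = 1 := by
      rw [nsmul_eq_mul, ZMod.natCast_zmod_val, inv_mul_cancel₀ hx0]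
    rw [← hf1, ← h1, map_nsmul, hx, smul_zero]
  obtain ⟨k, hk⟩ := circle_div f (ZMod.toAddCircle (N := p)) (by
    intro x hx; rw [hinj x hx, map_zero])
  refine ⟨k, ?_⟩
  rw [← hf1, hk]
  intro h
  rw [← map_zero (ZMod.toAddCircle (N := p))] at h
  exact one_ne_zero (ZMod.toAddCircle_injective p h)

theorem dominion_sub {A : Type u} [Group A] (hA : IsNil2 A) (B : Subgroup A) (n : ℕ)
    (hn : 0 < n) (hsq : Squarefree n) (hB : ∀ g ∈ B, g ^ n = 1)
    (hcmp : ∀ p : ℕ, p.Prime → ∀ a ∈ B, ∀ b ∈ B, (∀ h ∈ B, a * h = h * a) →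
      (∀ h ∈ B, b * h = h * b) → a ^ p = 1 → b ^ p = 1 →
      ∃ j : ℤ, a * b ^ (-j) ∈ commutator A ∨ b * a ^ (-j) ∈ commutator A) (a : A)
    (ha : a ∈ Dominion B) : a ∈ B := by
  by_contra haB
  obtain ⟨g, hg, z, hz, hzn, rfl⟩ := dominion_step1 hA B n hB a ha
  have hzB : z ∉ B := fun h => haB (B.mul_mem hg h)
  let K : AddSubgroup (Additive (Subgroup.center A)) :=
    (B.subgroupOf (Subgroup.center A)).toAddSubgroup
  have hK : ∀ c : Subgroup.center A, Additive.ofMul c ∈ K ↔ (c : A) ∈ B := fun c => Iff.rfl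
  let z0 : Additive (Subgroup.center A) := Additive.ofMul ⟨z, hA hz⟩
  have hz0 : (QuotientAddGroup.mk' K) z0 ≠ 0 := by
    intro h
    exact hzB ((hK _).1 ((QuotientAddGroup.eq_zero_iff z0).1 h))
  have hnz : n • z0 = 0 := by
    rw [← ofMul_pow]
    exact congrArg Additive.ofMul (Subtype.ext hzn)
  have hnz' : n • (QuotientAddGroup.mk' K) z0 = 0 := by
    rw [← map_nsmul, hnz, map_zero]
  have hone : addOrderOf ((QuotientAddGroup.mk' K) z0) ≠ 1 := by
    rwa [Ne, AddMonoid.addOrderOf_eq_one_iff]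
  obtain ⟨p, hp, hpd⟩ := Nat.exists_prime_and_dvd hone
  have : Fact p.Prime := ⟨hp⟩
  obtain ⟨m, rfl⟩ : p ∣ n := hpd.trans (addOrderOf_dvd_of_nsmul_eq_zero hnz')
  have hpm : Nat.Coprime p m := Nat.coprime_of_squarefree_mul hsq
  obtain ⟨χ', hχ'⟩ := exists_char p (m • (QuotientAddGroup.mk' K) z0) (by
      intro h
      have h1 := addOrderOf_dvd_of_nsmul_eq_zero h
      exact hp.one_lt.ne' (Nat.eq_one_of_dvd_coprimes hpm dvd_rfl (hpd.trans h1))) (by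
      rw [← mul_smul]; exact hnz')
  let χ : Additive (Subgroup.center A) →+ UnitAddCircle :=
    m • (χ'.comp (QuotientAddGroup.mk' K))
  have hχ : ∀ c, χ c = χ' (m • (QuotientAddGroup.mk' K) c) := by
    intro c; rw [map_nsmul]; rfl
  have hχB : ∀ c : Subgroup.center A, (c : A) ∈ B → χ (Additive.ofMul c) = 0 := by
    intro c hc
    have : (QuotientAddGroup.mk' K) (Additive.ofMul c) = 0 :=
      (QuotientAddGroup.eq_zero_iff _).2 ((hK c).2 hc)
    rw [hχ, this, smul_zero, map_zero]
  let κ : Additive (Abelianization A) →+ Additive (Abelianization A) →+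
      Additive (Subgroup.center A) :=
    AddMonoidHom.mk' (fun u => MonoidHom.toAdditive (cmU hA u.toMul)) (by
      intro u v
      refine AddMonoidHom.ext fun w => ?_
      show Additive.ofMul (cmU hA (u.toMul * v.toMul) w.toMul) = _
      rw [map_mul]; rfl)
  let q : A → Additive (Abelianization A) := fun x => Additive.ofMul (Abelianization.of x)
  have hq : Function.Surjective q := fun u => by
    obtain ⟨x, hx⟩ := QuotientGroup.mk_surjective u.toMul
    exact ⟨x, congrArg Additive.ofMul hx⟩
  have hqp : ∀ (k : ℕ) x, q (x ^ k) = k • q x := by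
    intro k x; simp [q]
  have hqz : ∀ (k : ℤ) x, q (x ^ k) = k • q x := by
    intro k x; simp [q]
  have hqm : ∀ x y, q (x * y) = q x + q y := by intro x y; simp [q]
  have hqc : ∀ x ∈ commutator A, q x = 0 := by
    intro x hx; simp [q, cmU_of_mem.1 hx]
  have hκ : ∀ x y, κ (q x) (q y) = Additive.ofMul (cm hA x y) := fun _ _ => rfl
  let W : AddSubgroup (Additive (Abelianization A)) := (B.map Abelianization.of).toAddSubgroup
  have hWq : ∀ x ∈ B, q x ∈ W := fun x hx => ⟨x, hx, rfl⟩
  have hWe : ∀ w ∈ W, ∃ x ∈ B, q x = w := by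
    rintro w ⟨x, hx, h⟩
    exact ⟨x, hx, congrArg Additive.ofMul h⟩
  have hcomm : ∀ x : A, (∀ w ∈ W, κ (q x) w = 0) → ∀ h ∈ B, x * h = h * x := by
    intro x hx h hh
    have h1 := hx _ (hWq h hh)
    rw [hκ] at h1
    have h2 : cm hA x h = 1 := h1
    have h3 : ⁅x, h⁆ = 1 := by rw [← cm_coe hA, h2]; rfl
    exact commutatorElement_eq_one_iff_mul_comm.1 h3
  obtain ⟨b, hb1, hb2⟩ := add_key κ (by
      intro u
      obtain ⟨x, rfl⟩ := hq u
      rw [hκ]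
      refine congrArg Additive.ofMul (Subtype.ext ?_)
      rw [cm_coe, commutatorElement_self]; rfl) W p m hpm (by
      intro w hw
      obtain ⟨x, hx, rfl⟩ := hWe w hw
      rw [← hqp, hB x hx]; simp [q]) (by
      intro v1 hv1 v2 hv2 h1 h2
      obtain ⟨x, hx, rfl⟩ := hWe v1 hv1
      obtain ⟨y, hy, rfl⟩ := hWe v2 hv2
      rw [← hqp] at h1 h2
      obtain ⟨j, h | h⟩ := hcmp p hp (x ^ m) (B.pow_mem hx m) (y ^ m) (B.pow_mem hy m)
        (hcomm _ h1) (hcomm _ h2) (by rw [← pow_mul, mul_comm, hB x hx])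
        (by rw [← pow_mul, mul_comm, hB y hy])
      · refine ⟨j, Or.inl ?_⟩
        have := hqc _ h
        rw [hqm, hqz, hqp, hqp, neg_smul, ← sub_eq_add_neg, sub_eq_zero] at this
        exact this
      · refine ⟨j, Or.inr ?_⟩
        have := hqc _ h
        rw [hqm, hqz, hqp, hqp, neg_smul, ← sub_eq_add_neg, sub_eq_zero] at this
        exact this) χ (by
      intro w hw w' hw'
      obtain ⟨x, hx, rfl⟩ := hWe w hw
      obtain ⟨y, hy, rfl⟩ := hWe w' hw'
      rw [hκ]
      apply hχB
      rw [cm_coe, commutatorElement_def]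
      exact B.mul_mem (B.mul_mem (B.mul_mem hx hy) (B.inv_mem hx)) (B.inv_mem hy)) (by
      intro u w hw
      obtain ⟨x, hx, rfl⟩ := hWe w hw
      have h0 : (p * m) • κ u (q x) = 0 := by
        rw [← map_nsmul, ← hqp, hB x hx]
        have : q 1 = 0 := by simp [q]
        rw [this, map_zero]
      rw [hχ, ← map_nsmul, ← mul_smul, ← map_nsmul, h0, map_zero, map_zero])
  obtain ⟨C, iC, hC, f1, f2, hf, hne⟩ := separate hA B χ hχB b
    (fun g hg u => hb1 _ (hWq g hg) u) (fun y g hg => by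
      rw [← hκ]; exact hb2 _ _ (hWq g hg)) z hz (by
      show χ z0 ≠ 0
      rw [hχ]; exact hχ')
  apply hne
  have := ha C hC f1 f2 hf
  rw [map_mul, map_mul, hf g hg] at this
  exact mul_left_cancel this

theorem cyclic_tors {Q : Type*} [Group Q] [IsCyclic Q] (p : ℕ) (hp : p.Prime) (x y : Q)
    (hx : x ^ p = 1) (hy : y ^ p = 1) : ∃ j : ℤ, x = y ^ j ∨ y = x ^ j := by
  obtain ⟨g, hg⟩ := IsCyclic.exists_generator (α := Q)
  obtain ⟨a, rfl⟩ := hg x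
  obtain ⟨b, rfl⟩ := hg y
  simp only at hx hy ⊢
  obtain ⟨a', ha'⟩ : (Int.gcd a b : ℤ) ∣ a := Int.gcd_dvd_left ..
  obtain ⟨b', hb'⟩ : (Int.gcd a b : ℤ) ∣ b := Int.gcd_dvd_right ..
  have hd := Int.gcd_eq_gcd_ab a b
  set d : ℤ := (Int.gcd a b : ℤ) with hdd
  set u := Int.gcdA a b
  set v := Int.gcdB a b
  have ht : g ^ (d * p) = 1 := by
    rw [← zpow_natCast, ← zpow_mul] at hx hy
    have : d * p = (a * p) * u + (b * p) * v := by rw [hd]; ring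
    rw [this, zpow_add, zpow_mul, zpow_mul g (b * p), hx, hy, one_zpow, one_zpow, one_mul]
  by_cases hpa : (p : ℤ) ∣ a'
  · obtain ⟨c, hc⟩ := hpa
    refine ⟨0, Or.inl ?_⟩
    rw [ha', hc, ← mul_assoc, zpow_mul, ht, one_zpow, zpow_zero]
  · have hcop : IsCoprime (p : ℤ) a' :=
      ((Nat.prime_iff_prime_int.1 hp).coprime_iff_not_dvd).2 hpa
    obtain ⟨α, γ, h⟩ := hcop
    refine ⟨γ * b', Or.inr ?_⟩
    have e : b = (d * p) * (α * b') + a * (γ * b') := by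
      calc b = d * b' * 1 := by rw [mul_one]; exact hb'
        _ = d * b' * (α * p + γ * a') := by rw [h]
        _ = (d * p) * (α * b') + (d * a') * (γ * b') := by ring
        _ = _ := by rw [← ha']
    rw [← zpow_mul]
    conv_lhs => rw [e]
    rw [zpow_add, zpow_mul g (d * p), ht, one_zpow, one_mul]

theorem closed_of_cyclic {G : Type u} [Group G]
    (n : ℕ) (hn : 0 < n) (hsq : Squarefree n) (hexp : Monoid.exponent G = n)
    (hcyc : IsCyclic (↥(Subgroup.center G) ⧸ (commutator G).subgroupOf (Subgroup.center G))) :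
    IsAbsolutelyClosed G := by
  intro A _ hA ι hι
  apply Set.Subset.antisymm
  · intro a ha
    refine dominion_sub hA ι.range n hn hsq ?_ ?_ a ha
    · rintro _ ⟨g, rfl⟩
      rw [← map_pow, ← hexp, Monoid.pow_exponent_eq_one, map_one]
    · rintro p hp _ ⟨a, rfl⟩ _ ⟨b, rfl⟩ hca hcb hap hbp
      have hcen : ∀ a : G, (∀ h ∈ ι.range, ι a * h = h * ι a) → a ∈ Subgroup.center G := by
        intro a h
        rw [Subgroup.mem_center_iff]
        intro g
        apply hι
        rw [map_mul, map_mul]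
        exact (h _ ⟨g, rfl⟩).symm
      have hpow : ∀ a : G, ι a ^ p = 1 → a ^ p = 1 := by
        intro a h
        apply hι
        rw [map_pow, h, map_one]
      let a' : Subgroup.center G := ⟨a, hcen a hca⟩
      let b' : Subgroup.center G := ⟨b, hcen b hcb⟩
      have ha' : a' ^ p = 1 := Subtype.ext (hpow a hap)
      have hb' : b' ^ p = 1 := Subtype.ext (hpow b hbp)
      have key : ∀ c d : Subgroup.center G, ∀ j : ℤ,
          (QuotientGroup.mk' ((commutator G).subgroupOf (Subgroup.center G))) c =
          (QuotientGroup.mk' ((commutator G).subgroupOf (Subgroup.center G))) d ^ j →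
          ι (c : G) * ι (d : G) ^ (-j) ∈ commutator A := by
        intro c d j h
        have h1 : (QuotientGroup.mk' ((commutator G).subgroupOf (Subgroup.center G)))
            (c * d ^ (-j)) = 1 := by
          rw [map_mul, map_zpow, h, ← zpow_add, add_neg_cancel, zpow_zero]
        have h2 : (c * d ^ (-j) : Subgroup.center G) ∈
          (commutator G).subgroupOf (Subgroup.center G) := (QuotientGroup.eq_one_iff _).1 h1
        have h3 : (c : G) * (d : G) ^ (-j) ∈ commutator G := by
          simpa [Subgroup.mem_subgroupOf] using h2
        rw [← map_zpow, ← map_mul, cmU_of_mem]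
        have h4 : (Abelianization.of.comp ι) ((c : G) * (d : G) ^ (-j)) = 1 := by
          have := Abelianization.commutator_subset_ker (Abelianization.of.comp ι)
          exact this h3
        exact h4
      obtain ⟨j, h | h⟩ := cyclic_tors p hp
        ((QuotientGroup.mk' ((commutator G).subgroupOf (Subgroup.center G))) a')
        ((QuotientGroup.mk' ((commutator G).subgroupOf (Subgroup.center G))) b')
        (by rw [← map_pow, ha', map_one]) (by rw [← map_pow, hb', map_one])
      · exact ⟨j, Or.inl (key a' b' j h)⟩
      · exact ⟨j, Or.inr (key b' a' j h)⟩
  · intro a ha C _ _ f g hfg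
    exact hfg a ha

theorem exists_indep {Q : Type*} [CommGroup Q] (n : ℕ) (hn : 0 < n) (hsq : Squarefree n)
    (hQ : ∀ q : Q, q ^ n = 1) (hnc : ¬ IsCyclic Q) :
    ∃ p m : ℕ, p.Prime ∧ n = p * m ∧ ∃ g q : Q, ∀ i j : ℤ, (g ^ m) ^ i * (q ^ m) ^ j = 1 →
      (p : ℤ) ∣ i ∧ (p : ℤ) ∣ j := by
  have hex : Monoid.ExponentExists Q := ⟨n, hn, hQ⟩
  obtain ⟨g, hg⟩ := Monoid.exists_orderOf_eq_exponent hex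
  obtain ⟨q, hq⟩ : ∃ q : Q, q ∉ Subgroup.zpowers g := by
    by_contra! h
    exact hnc ⟨g, h⟩
  let F := QuotientGroup.mk' (Subgroup.zpowers g)
  have hF : ∀ t, F t = 1 ↔ t ∈ Subgroup.zpowers g := fun t => QuotientGroup.eq_one_iff t
  have h1 : orderOf (F q) ≠ 1 := by
    rw [Ne, orderOf_eq_one_iff, hF]; exact hq
  obtain ⟨p, hp, hpd⟩ := Nat.exists_prime_and_dvd h1
  have : Fact p.Prime := ⟨hp⟩
  obtain ⟨m, rfl⟩ : p ∣ n := hpd.trans (orderOf_dvd_of_pow_eq_one (by rw [← map_pow, hQ, map_one]))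
  have hpm : Nat.Coprime p m := Nat.coprime_of_squarefree_mul hsq
  have hpm' : ¬ p ∣ m := fun h => hp.one_lt.ne' (Nat.eq_one_of_dvd_coprimes hpm dvd_rfl h)
  have hy : q ^ m ∉ Subgroup.zpowers g := by
    intro h
    rw [← hF, map_pow] at h
    exact hpm' (hpd.trans (orderOf_dvd_of_pow_eq_one h))
  have hpp : ∀ t : Q, (t ^ m) ^ p = 1 := by
    intro t; rw [← pow_mul, mul_comm, hQ]
  have hyo : orderOf (q ^ m) = p := orderOf_eq_prime (hpp q) (by
    intro h; exact hy (by rw [h]; exact Subgroup.one_mem _))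
  have hpe : p ∣ orderOf g := by
    rw [hg, ← hyo]; exact Monoid.order_dvd_exponent _
  have hxo : orderOf (g ^ m) = p := orderOf_eq_prime (hpp g) (by
    intro h; exact hpm' (hpe.trans (orderOf_dvd_of_pow_eq_one h)))
  refine ⟨p, m, hp, rfl, g, q, fun i j hij => ?_⟩
  have hj : (p : ℤ) ∣ j := by
    by_contra hj
    obtain ⟨α, γ, h⟩ : IsCoprime (p : ℤ) j :=
      ((Nat.prime_iff_prime_int.1 hp).coprime_iff_not_dvd).2 hj
    apply hy
    have e : q ^ m = ((q ^ m) ^ j) ^ γ := by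
      rw [← zpow_mul]
      conv_lhs => rw [← zpow_one (q ^ m), ← h, zpow_add, mul_comm α, zpow_mul, zpow_natCast, hpp,
        one_zpow, one_mul, mul_comm γ]
    rw [e]
    apply Subgroup.zpow_mem
    rw [eq_inv_of_mul_eq_one_right hij]
    exact Subgroup.inv_mem _ (Subgroup.zpow_mem _ (Subgroup.pow_mem _ (Subgroup.mem_zpowers g) _) _)
  refine ⟨?_, hj⟩
  have : (q ^ m) ^ j = 1 := by rw [← orderOf_dvd_iff_zpow_eq_one, hyo]; exact hj
  rw [this, mul_one, ← orderOf_dvd_iff_zpow_eq_one, hxo] at hij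
  exact hij

theorem exists_homs {G : Type*} [Group G] (p m : ℕ) [Fact p.Prime] (hpm : Nat.Coprime p m)
    (hG : ∀ g : G, g ^ (p * m) = 1) (x y : G) (hx : x ^ p = 1) (hy : y ^ p = 1)
    (hxy : ∀ i j : ℤ, x ^ i * y ^ j ∈ commutator G → (p : ℤ) ∣ i ∧ (p : ℤ) ∣ j) :
    ∃ φ ψ : G → ZMod p, (∀ g h, φ (g * h) = φ g + φ h) ∧ (∀ g h, ψ (g * h) = ψ g + ψ h) ∧
      φ x = 1 ∧ φ y = 0 ∧ ψ x = 0 ∧ ψ y = 1 := by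
  let q : G → Additive (Abelianization G) := fun x => Additive.ofMul (Abelianization.of x)
  have hq : Function.Surjective q := fun u => by
    obtain ⟨x, hx⟩ := QuotientGroup.mk_surjective u.toMul
    exact ⟨x, congrArg Additive.ofMul hx⟩
  have hqp : ∀ (k : ℕ) x, q (x ^ k) = k • q x := by
    intro k x; simp [q]
  have hqz : ∀ (k : ℤ) x, q (x ^ k) = k • q x := by
    intro k x; simp [q]
  have hqm : ∀ x y, q (x * y) = q x + q y := by intro x y; simp [q]
  have hq1 : q 1 = 0 := by simp [q]
  let π : G → ModN (Additive (Abelianization G)) p := fun g => ModN.mkQ p (q g)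
  let T : ZMod p × ZMod p →ₗ[ZMod p] ModN (Additive (Abelianization G)) p :=
    (LinearMap.toSpanSingleton (ZMod p) _ (π x)).coprod (LinearMap.toSpanSingleton (ZMod p) _ (π y))
  have hT : ∀ a b, T (a, b) = a • π x + b • π y := by intro a b; simp [T]
  have hTi : LinearMap.ker T = ⊥ := by
    rw [LinearMap.ker_eq_bot']
    rintro ⟨a, b⟩ hab
    obtain ⟨i, rfl⟩ := ZMod.intCast_surjective a
    obtain ⟨j, rfl⟩ := ZMod.intCast_surjective b
    rw [hT, Int.cast_smul_eq_zsmul, Int.cast_smul_eq_zsmul, ← map_zsmul (ModN.mkQ p),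
      ← map_zsmul (ModN.mkQ p), ← map_add (ModN.mkQ p), ← hqz, ← hqz, ← hqm,
      modN_mk_eq_zero] at hab
    obtain ⟨s, hs⟩ := hab
    obtain ⟨t, rfl⟩ := hq s
    have h1 : m • q (x ^ i * y ^ j) = 0 := by
      rw [hs, ← mul_smul, mul_comm, ← hqp, hG, hq1]
    have h2 : p • q (x ^ i * y ^ j) = 0 := by
      rw [hqm, hqz, hqz, smul_add, smul_comm, ← hqp, hx, smul_comm, ← hqp, hy, hq1, smul_zero,
        smul_zero, add_zero]
    have h3 : q (x ^ i * y ^ j) = 0 := by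
      have d1 := addOrderOf_dvd_of_nsmul_eq_zero h1
      have d2 := addOrderOf_dvd_of_nsmul_eq_zero h2
      exact AddMonoid.addOrderOf_eq_one_iff.1 (Nat.eq_one_of_dvd_coprimes hpm d2 d1)
    obtain ⟨hi, hj⟩ := hxy i j (cmU_of_mem.2 h3)
    exact Prod.ext ((ZMod.intCast_zmod_eq_zero_iff_dvd _ _).2 hi)
      ((ZMod.intCast_zmod_eq_zero_iff_dvd _ _).2 hj)
  obtain ⟨L, hL⟩ := T.exists_leftInverse_of_injective hTi
  have hL' : ∀ a b, L (T (a, b)) = (a, b) := fun a b => DFunLike.congr_fun hL (a, b)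
  have hLx : L (π x) = (1, 0) := by
    rw [← hL', hT]; simp
  have hLy : L (π y) = (0, 1) := by
    rw [← hL', hT]; simp
  have hπ : ∀ g h, π (g * h) = π g + π h := by
    intro g h; simp only [π, hqm, map_add]
  refine ⟨fun g => (L (π g)).1, fun g => (L (π g)).2, ?_, ?_, ?_, ?_, ?_, ?_⟩
  · intro g h; simp only [hπ, map_add, Prod.fst_add]
  · intro g h; simp only [hπ, map_add, Prod.snd_add]
  all_goals simp only [hLx, hLy]

theorem pow_val_add {G : Type*} [Group G] {p : ℕ} [NeZero p] {x : G} (hx : x ^ p = 1)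
    (a b : ZMod p) : x ^ (a + b).val = x ^ a.val * x ^ b.val := by
  rw [ZMod.val_add, ← pow_eq_pow_mod _ hx, pow_add]

theorem mulp_add {p : ℕ} [NeZero p] (a b : ZMod p) :
    ((p * (a + b).val : ℕ) : ZMod (p * p)) = (p * a.val : ℕ) + (p * b.val : ℕ) := by
  rw [ZMod.val_add, ← Nat.cast_add, ← mul_add, ZMod.natCast_eq_natCast_iff]
  exact Nat.ModEq.mul_left' p (Nat.mod_modEq _ _)

/-- Heisenberg cocycle -/
def hb (R : Type*) [CommRing R] : (Multiplicative R × Multiplicative R) →*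
    (Multiplicative R × Multiplicative R) →* Multiplicative R :=
  MonoidHom.mk' (fun s => MonoidHom.mk' (fun r =>
    Multiplicative.ofAdd (s.1.toAdd * r.2.toAdd)) (by
      intro r r'
      rw [← ofAdd_add, ← mul_add]; rfl)) (by
      intro s s'
      refine MonoidHom.ext fun r => ?_
      show Multiplicative.ofAdd ((s.1.toAdd + s'.1.toAdd) * r.2.toAdd) =
        Multiplicative.ofAdd (s.1.toAdd * r.2.toAdd) * Multiplicative.ofAdd (s'.1.toAdd * r.2.toAdd)
      rw [add_mul, ofAdd_add])

theorem hb_apply (R : Type*) [CommRing R] (s r : Multiplicative R × Multiplicative R) :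
    hb R s r = Multiplicative.ofAdd (s.1.toAdd * r.2.toAdd) := rfl

/-- Elements of the Heisenberg group. -/
def H3 {R : Type*} [CommRing R] (a b c : R) : CExt (hb R) :=
  ⟨(Multiplicative.ofAdd a, Multiplicative.ofAdd b), Multiplicative.ofAdd c⟩

theorem H3_mul {R : Type*} [CommRing R] (a b c a' b' c' : R) :
    H3 a b c * H3 a' b' c' = H3 (a + a') (b + b') (c + c' + a * b') := rfl

theorem H3_one {R : Type*} [CommRing R] : (H3 0 0 0 : CExt (hb R)) = 1 := rfl

theorem H3_pow1 {R : Type*} [CommRing R] (k : ℕ) : (H3 1 0 0 : CExt (hb R)) ^ k = H3 (k : R) 0 0 := by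
  induction k with
  | zero => rw [pow_zero, Nat.cast_zero, H3_one]
  | succ k ih => rw [pow_succ, ih, H3_mul]; simp

theorem H3_pow2 {R : Type*} [CommRing R] (k : ℕ) : (H3 0 1 0 : CExt (hb R)) ^ k = H3 0 (k : R) 0 := by
  induction k with
  | zero => rw [pow_zero, Nat.cast_zero, H3_one]
  | succ k ih => rw [pow_succ, ih, H3_mul]; simp

theorem H3_pow3 {R : Type*} [CommRing R] (k : ℕ) : (H3 0 0 1 : CExt (hb R)) ^ k = H3 0 0 (k : R) := by
  induction k with
  | zero => rw [pow_zero, Nat.cast_zero, H3_one]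
  | succ k ih => rw [pow_succ, ih, H3_mul]; simp

theorem H3_comm {R : Type*} [CommRing R] : ⁅(H3 1 0 0 : CExt (hb R)), (H3 0 1 0 : CExt (hb R))⁆ =
    H3 0 0 1 := by
  rw [commutatorElement_def, mul_inv_eq_iff_eq_mul, mul_inv_eq_iff_eq_mul, H3_mul, H3_mul, H3_mul]
  simp

theorem not_closed {G : Type u} [Group G] (hG : IsNil2 G) (p : ℕ) [Fact p.Prime]
    (x y : G) (hxc : x ∈ Subgroup.center G) (hyc : y ∈ Subgroup.center G)
    (hx : x ^ p = 1) (hy : y ^ p = 1) (φ ψ : G → ZMod p)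
    (hφ : ∀ g h, φ (g * h) = φ g + φ h) (hψ : ∀ g h, ψ (g * h) = ψ g + ψ h)
    (hφx : φ x = 1) (hφy : φ y = 0) (hψx : ψ x = 0) (hψy : ψ y = 1) :
    ¬ IsAbsolutelyClosed G := by
  intro hcl
  have hp : p.Prime := Fact.out
  have : Fact (1 < p) := ⟨hp.one_lt⟩
  let R := ZMod (p * p)
  let E := CExt (hb R)
  have hE : IsNil2 E := CExt.isNil2 (isNil2_of fun x y z => mul_comm _ _)
  have hA : IsNil2 (G × E) := by
    apply isNil2_of
    rintro ⟨x1, x2⟩ ⟨y1, y2⟩ ⟨z1, z2⟩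
    exact Prod.ext (Subgroup.mem_center_iff.1 (hG.comm_mem x1 y1) z1)
      (Subgroup.mem_center_iff.1 (hE.comm_mem x2 y2) z2)
  let mp : ZMod p → R := fun a => ((p * a.val : ℕ) : R)
  have hmp : ∀ a b, mp (a + b) = mp a + mp b := mulp_add
  have hmm : ∀ a b, mp a * mp b = 0 := by
    intro a b
    simp only [mp]
    rw [← Nat.cast_mul, ZMod.natCast_eq_zero_iff]
    exact ⟨a.val * b.val, by ring⟩
  have hm0 : ∀ a, mp a = 0 → a = 0 := by
    intro a h
    have h1 := (ZMod.natCast_eq_zero_iff _ _).1 h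
    have h2 := Nat.dvd_of_mul_dvd_mul_left hp.pos h1
    exact (ZMod.val_eq_zero a).1 (Nat.eq_zero_of_dvd_of_lt h2 (ZMod.val_lt a))
  have hxk : ∀ k g, g * (x ^ k)⁻¹ = (x ^ k)⁻¹ * g := fun k g =>
    Subgroup.mem_center_iff.1 (Subgroup.inv_mem _ (Subgroup.pow_mem _ hxc k)) g
  have hyk : ∀ k g, g * (y ^ k)⁻¹ = (y ^ k)⁻¹ * g := fun k g =>
    Subgroup.mem_center_iff.1 (Subgroup.inv_mem _ (Subgroup.pow_mem _ hyc k)) g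
  let ι : G →* G × E := MonoidHom.mk' (fun g => ((y ^ (ψ g).val)⁻¹ * ((x ^ (φ g).val)⁻¹ * g),
      ⟨(Multiplicative.ofAdd (mp (φ g)), Multiplicative.ofAdd (mp (ψ g))), 1⟩)) (by
    intro g h
    refine Prod.ext ?_ (CExt.ext ?_ ?_)
    · show (y ^ (ψ (g * h)).val)⁻¹ * ((x ^ (φ (g * h)).val)⁻¹ * (g * h)) =
        (y ^ (ψ g).val)⁻¹ * ((x ^ (φ g).val)⁻¹ * g) * ((y ^ (ψ h).val)⁻¹ * ((x ^ (φ h).val)⁻¹ * h))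
      rw [hφ, hψ, pow_val_add hx, pow_val_add hy, mul_inv_rev, mul_inv_rev]
      set a := (y ^ (ψ g).val)⁻¹
      set c := (x ^ (φ g).val)⁻¹
      have hb1 := hyk (ψ h).val
      have hd1 := hxk (φ h).val
      set b := (y ^ (ψ h).val)⁻¹
      set d := (x ^ (φ h).val)⁻¹
      calc b * a * (d * c * (g * h)) = (b * a) * ((d * c) * g) * h := by group
        _ = (a * b) * ((c * d) * g) * h := by rw [← hb1 a, ← hd1 c]
        _ = a * (b * c) * (d * g) * h := by group
        _ = a * (c * b) * (g * d) * h := by rw [← hb1 c, ← hd1 g]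
        _ = a * c * (b * g) * d * h := by group
        _ = a * c * (g * b) * d * h := by rw [← hb1 g]
        _ = _ := by group
    · show ((Multiplicative.ofAdd (mp (φ (g * h))), Multiplicative.ofAdd (mp (ψ (g * h)))) :
        Multiplicative R × Multiplicative R) = (Multiplicative.ofAdd (mp (φ g) + mp (φ h)),
          Multiplicative.ofAdd (mp (ψ g) + mp (ψ h)))
      rw [hφ, hψ, hmp, hmp]
    · show (1 : Multiplicative R) = 1 * 1 * Multiplicative.ofAdd (mp (φ g) * mp (ψ h))
      rw [hmm]; simp)
  have hιi : Function.Injective ι := by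
    rw [injective_iff_map_eq_one]
    intro g hg
    have h2 : (Multiplicative.ofAdd (mp (φ g)), Multiplicative.ofAdd (mp (ψ g))) =
      ((1, 1) : Multiplicative R × Multiplicative R) := congrArg (fun e => e.2.fst) hg
    have hφ0 : φ g = 0 := hm0 _ (congrArg (fun e => Multiplicative.toAdd e.1) h2)
    have hψ0 : ψ g = 0 := hm0 _ (congrArg (fun e => Multiplicative.toAdd e.2) h2)
    have h1 : (y ^ (ψ g).val)⁻¹ * ((x ^ (φ g).val)⁻¹ * g) = 1 := congrArg Prod.fst hg
    simpa [hφ0, hψ0] using h1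
  have hcl' := hcl (G × E) hA ι hιi
  let r : G × E := (1, H3 1 0 0)
  let s : G × E := (1, H3 0 1 0)
  let c : G × E := (1, H3 0 0 1)
  have hr : r ^ p = (1, H3 (p : R) 0 0) := Prod.ext (one_pow p) (H3_pow1 p)
  have hs : s ^ p = (1, H3 0 (p : R) 0) := Prod.ext (one_pow p) (H3_pow2 p)
  have hc : c ^ p = (1, H3 0 0 (p : R)) := Prod.ext (one_pow p) (H3_pow3 p)
  have hrs : ⁅r, s⁆ = c := Prod.ext (commutatorElement_self (1 : G)) H3_comm
  have hιx : ι x = r ^ p := by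
    rw [hr]
    refine Prod.ext ?_ (CExt.ext ?_ rfl)
    · show (y ^ (ψ x).val)⁻¹ * ((x ^ (φ x).val)⁻¹ * x) = 1
      rw [hφx, hψx, ZMod.val_one]; simp
    · show ((Multiplicative.ofAdd (mp (φ x)), Multiplicative.ofAdd (mp (ψ x))) :
        Multiplicative R × Multiplicative R) = (Multiplicative.ofAdd (p : R), 1)
      rw [hφx, hψx]; simp [mp, ZMod.val_one]
  have hιy : ι y = s ^ p := by
    rw [hs]
    refine Prod.ext ?_ (CExt.ext ?_ rfl)
    · show (y ^ (ψ y).val)⁻¹ * ((x ^ (φ y).val)⁻¹ * y) = 1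
      rw [hφy, hψy, ZMod.val_one]; simp
    · show ((Multiplicative.ofAdd (mp (φ y)), Multiplicative.ofAdd (mp (ψ y))) :
        Multiplicative R × Multiplicative R) = (1, Multiplicative.ofAdd (p : R))
      rw [hφy, hψy]; simp [mp, ZMod.val_one]
  have hdom : c ^ p ∈ Dominion ι.range := by
    intro C _ hC f g hfg
    have e1 : f r ^ p = g r ^ p := by
      rw [← map_pow, ← map_pow, ← hιx]; exact hfg _ ⟨x, rfl⟩
    have e2 : f s ^ p = g s ^ p := by
      rw [← map_pow, ← map_pow, ← hιy]; exact hfg _ ⟨y, rfl⟩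
    have key : (cm hC (f r) (f s)) ^ p = (cm hC (g r) (g s)) ^ p := by
      calc (cm hC (f r) (f s)) ^ p = cm hC (f r ^ p) (f s) := by
            rw [map_pow]; rfl
        _ = cm hC (g r) (f s ^ p) := by rw [e1, map_pow, map_pow]; rfl
        _ = _ := by rw [e2, map_pow]
    have hh : ∀ f : G × E →* C, f (c ^ p) = ((cm hC (f r) (f s)) ^ p : Subgroup.center C) := by
      intro f
      rw [← hrs, map_pow, map_commutatorElement]; rfl
    rw [hh f, hh g, key]
  rw [hcl', hc] at hdom
  obtain ⟨g, hg⟩ := hdom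
  have h1 : (1 : Multiplicative R) = Multiplicative.ofAdd (p : R) := congrArg (fun e => e.2.snd) hg
  have h2 : (p : R) = 0 := (congrArg Multiplicative.toAdd h1).symm
  have h3 := (ZMod.natCast_eq_zero_iff _ _).1 h2
  have h4 := Nat.le_of_dvd hp.pos h3
  nlinarith [hp.one_lt]

theorem cyclic_of_closed {G : Type u} [Group G] (hG : IsNil2 G)
    (n : ℕ) (hn : 0 < n) (hsq : Squarefree n) (hexp : Monoid.exponent G = n)
    (hcl : IsAbsolutelyClosed G) :
    IsCyclic (↥(Subgroup.center G) ⧸ (commutator G).subgroupOf (Subgroup.center G)) := by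
  by_contra hnc
  have hGn : ∀ g : G, g ^ n = 1 := by
    intro g; rw [← hexp]; exact Monoid.pow_exponent_eq_one g
  let F := QuotientGroup.mk' ((commutator G).subgroupOf (Subgroup.center G))
  obtain ⟨p, m, hp, hnpm, g, q, hind⟩ := exists_indep
    (Q := ↥(Subgroup.center G) ⧸ (commutator G).subgroupOf (Subgroup.center G)) n hn hsq (by
      intro q
      obtain ⟨q, rfl⟩ := QuotientGroup.mk_surjective q
      have : q ^ n = 1 := Subtype.ext (hGn q)
      show F q ^ n = 1
      rw [← map_pow, this, map_one]) hnc
  subst hnpm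
  have : Fact p.Prime := ⟨hp⟩
  have hpm : Nat.Coprime p m := Nat.coprime_of_squarefree_mul hsq
  obtain ⟨g, rfl⟩ := QuotientGroup.mk_surjective g
  obtain ⟨q, rfl⟩ := QuotientGroup.mk_surjective q
  have hpp : ∀ t : G, (t ^ m) ^ p = 1 := by
    intro t; rw [← pow_mul, mul_comm, hGn]
  obtain ⟨φ, ψ, h1, h2, h3, h4, h5, h6⟩ := exists_homs p m hpm hGn ((g : G) ^ m) ((q : G) ^ m)
    (hpp _) (hpp _) (by
      intro i j hij
      apply hind
      have : (g ^ m) ^ i * (q ^ m) ^ j ∈ (commutator G).subgroupOf (Subgroup.center G) := by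
        simpa [Subgroup.mem_subgroupOf] using hij
      exact (QuotientGroup.eq_one_iff _).2 this)
  exact not_closed hG p _ _ (Subgroup.pow_mem _ g.2 m) (Subgroup.pow_mem _ q.2 m) (hpp _) (hpp _)
    φ ψ h1 h2 h3 h4 h5 h6 hcl

end Main

/-- A nil-2 group of squarefree exponent `n` is absolutely closed in `N₂` iff
`Z(G)/[G,G]` is cyclic. -/
theorem squarefree_exponent_absolutelyClosed_iff {G : Type u} [Group G] (hG : IsNil2 G)
    (n : ℕ) (hn : 0 < n) (hsq : Squarefree n) (hexp : Monoid.exponent G = n) :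
    IsAbsolutelyClosed G ↔
      IsCyclic (↥(Subgroup.center G) ⧸ (commutator G).subgroupOf (Subgroup.center G)) := by
  exact ⟨cyclic_of_closed hG n hn hsq hexp, closed_of_cyclic n hn hsq hexp⟩
end

section
/- Let G be a finitely generated torsion group of nilpotency class at most 2. If G is absolutely closed in N₂, then the quotient group Z(G)/[G,G] is cyclic. -/
universe u

open scoped commutatorElement

/-- Central-type extension of `G × ℤ × ℤ` by `D` along a bilinear cocycle. -/
@[ext]
structure Ext2 {G : Type u} [Group G] {D : Type} [AddCommGroup D]
    (χ ψ : Additive G →+ D) (w : D) : Type u where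
  g : G
  c : D
  i : ℤ
  j : ℤ

namespace Ext2

variable {G : Type u} [Group G] {D : Type} [AddCommGroup D]
  {χ ψ : Additive G →+ D} {w : D}

instance : Mul (Ext2 χ ψ w) :=
  ⟨fun a b => ⟨a.g * b.g,
    a.c + b.c + (b.j • χ (Additive.ofMul a.g) + b.i • ψ (Additive.ofMul a.g) + (a.i * b.j) • w),
    a.i + b.i, a.j + b.j⟩⟩

instance : One (Ext2 χ ψ w) := ⟨⟨1, 0, 0, 0⟩⟩

instance : Inv (Ext2 χ ψ w) :=
  ⟨fun a => ⟨a.g⁻¹,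
    -a.c + (a.j • χ (Additive.ofMul a.g) + a.i • ψ (Additive.ofMul a.g) + (a.i * a.j) • w),
    -a.i, -a.j⟩⟩

@[simp] theorem mul_g (a b : Ext2 χ ψ w) : (a * b).g = a.g * b.g := rfl
@[simp] theorem mul_i (a b : Ext2 χ ψ w) : (a * b).i = a.i + b.i := rfl
@[simp] theorem mul_j (a b : Ext2 χ ψ w) : (a * b).j = a.j + b.j := rfl
@[simp] theorem mul_c (a b : Ext2 χ ψ w) : (a * b).c =
    a.c + b.c + (b.j • χ (Additive.ofMul a.g) + b.i • ψ (Additive.ofMul a.g)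
      + (a.i * b.j) • w) := rfl
@[simp] theorem one_g : (1 : Ext2 χ ψ w).g = 1 := rfl
@[simp] theorem one_c : (1 : Ext2 χ ψ w).c = 0 := rfl
@[simp] theorem one_i : (1 : Ext2 χ ψ w).i = 0 := rfl
@[simp] theorem one_j : (1 : Ext2 χ ψ w).j = 0 := rfl
@[simp] theorem inv_g (a : Ext2 χ ψ w) : (a⁻¹).g = a.g⁻¹ := rfl
@[simp] theorem inv_i (a : Ext2 χ ψ w) : (a⁻¹).i = -a.i := rfl
@[simp] theorem inv_j (a : Ext2 χ ψ w) : (a⁻¹).j = -a.j := rfl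
@[simp] theorem inv_c (a : Ext2 χ ψ w) : (a⁻¹).c =
    -a.c + (a.j • χ (Additive.ofMul a.g) + a.i • ψ (Additive.ofMul a.g)
      + (a.i * a.j) • w) := rfl

instance : Group (Ext2 χ ψ w) :=
  Group.ofLeftAxioms
    (by
      intro a b c
      ext
      · simp [mul_assoc]
      · simp only [mul_c, mul_g, mul_i, mul_j, ofMul_mul, map_add]
        module
      · simp [add_assoc]
      · simp [add_assoc])
    (by intro a; ext <;> simp)
    (by
      intro a
      ext
      · simp
      · simp only [mul_c, inv_g, inv_c, inv_i, one_c, ofMul_inv, map_neg]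
        module
      · simp
      · simp)

theorem map_comm (χ : Additive G →+ D) (a b : G) : χ (Additive.ofMul ⁅a, b⁆) = 0 := by
  simp only [commutatorElement_def, ofMul_mul, ofMul_inv, map_add, map_neg]
  abel

theorem nil2 (hG : ∀ a b c : G, ⁅a, b⁆ * c = c * ⁅a, b⁆) (a b c : Ext2 χ ψ w) :
    ⁅a, b⁆ * c = c * ⁅a, b⁆ := by
  have h1 : ⁅a, b⁆.i = 0 := by simp [commutatorElement_def]
  have h2 : ⁅a, b⁆.j = 0 := by simp [commutatorElement_def]
  have h3 : ⁅a, b⁆.g = ⁅a.g, b.g⁆ := by simp [commutatorElement_def]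
  ext
  · simp only [mul_g, h3, hG]
  · simp only [mul_c, h1, h2, h3, map_comm]
    module
  · simp [h1]
  · simp [h2]

/-- The embedding of `G`. -/
def inG (χ ψ : Additive G →+ D) (w : D) : G →* Ext2 χ ψ w where
  toFun g := ⟨g, 0, 0, 0⟩
  map_one' := rfl
  map_mul' a b := by ext <;> simp

/-- The subgroup of relations. -/
def rel (χ ψ : Additive G →+ D) (w : D) (x y : G) (n : ℕ) (hxy : x * y = y * x)
    (hχy : χ (.ofMul y) = 0) (hψx : ψ (.ofMul x) = 0)
    (hχx : χ (.ofMul x) = n • w) (hn : ∀ g, n • ψ g = 0) :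
    Subgroup (Ext2 χ ψ w) where
  carrier := {q | ∃ a b : ℤ, q = ⟨x ^ (-a) * y ^ (-b), 0, n * a, n * b⟩}
  one_mem' := ⟨0, 0, by ext <;> simp⟩
  mul_mem' := by
    rintro _ _ ⟨a, b, rfl⟩ ⟨a', b', rfl⟩
    have hc : Commute x y := hxy
    have hn' : ∀ g, (n : ℤ) • ψ g = 0 := by simpa using hn
    refine ⟨a + a', b + b', ?_⟩
    ext
    · have := (hc.zpow_zpow (-a') (-b)).eq
      simp only [mul_g, neg_add, zpow_add]
      rw [mul_assoc, ← mul_assoc (y ^ (-b)), ← this]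
      simp only [mul_assoc]
    · simp only [mul_c, ofMul_mul, ofMul_zpow, map_add, map_zsmul, hχy, hψx, hχx]
      have : ((n:ℤ) * a') • (-b) • ψ (.ofMul y) = (-(b * a')) • ((n:ℤ) • ψ (.ofMul y)) := by module
      simp only [smul_zero, zero_add, add_zero]
      rw [this, hn']
      module
    · simp; ring
    · simp; ring
  inv_mem' := by
    rintro _ ⟨a, b, rfl⟩
    have hc : Commute x y := hxy
    have hn' : ∀ g, (n : ℤ) • ψ g = 0 := by simpa using hn
    refine ⟨-a, -b, ?_⟩
    ext
    · have := (hc.zpow_zpow (a) (b)).eq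
      simp [this]
    · simp only [inv_c, ofMul_mul, ofMul_zpow, map_add, map_zsmul, hχy, hψx, hχx]
      have : ((n:ℤ) * a) • (-b) • ψ (.ofMul y) = (-(b * a)) • ((n:ℤ) • ψ (.ofMul y)) := by module
      simp only [smul_zero, zero_add, add_zero]
      rw [this, hn']
      module
    · simp
    · simp

end Ext2

theorem nil2_iff {C : Type*} [Group C] :
    IsNil2 C ↔ ∀ a b c : C, ⁅a, b⁆ * c = c * ⁅a, b⁆ := by
  unfold IsNil2
  rw [commutator_def, Subgroup.commutator_le]
  simp only [Subgroup.mem_top, true_implies, Subgroup.mem_center_iff]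
  exact ⟨fun h a b c => (h a b c).symm, fun h a b c => (h a b c).symm⟩

theorem comm_pow_left {C : Type*} [Group C] (h : ∀ a b c : C, ⁅a, b⁆ * c = c * ⁅a, b⁆)
    (a b : C) (n : ℕ) : ⁅a ^ n, b⁆ = ⁅a, b⁆ ^ n := by
  induction n with
  | zero => simp
  | succ n ih =>
    have : ⁅a ^ (n + 1), b⁆ = a ^ n * ⁅a, b⁆ * (b * (a ^ n)⁻¹ * b⁻¹) := by
      simp only [commutatorElement_def, pow_succ]; group
    rw [this, ← h, mul_assoc, pow_succ', ← ih]
    simp only [commutatorElement_def]; group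

theorem comm_pow_right {C : Type*} [Group C] (h : ∀ a b c : C, ⁅a, b⁆ * c = c * ⁅a, b⁆)
    (a b : C) (n : ℕ) : ⁅a, b ^ n⁆ = ⁅a, b⁆ ^ n := by
  rw [← commutatorElement_inv, comm_pow_left h, ← inv_pow, commutatorElement_inv]

theorem mem_dominion {A : Type u} [Group A] (B : Subgroup A) (r s : A) (n : ℕ)
    (hr : r ^ n ∈ B) (hs : s ^ n ∈ B) : ⁅r, s⁆ ^ n ∈ Dominion B := by
  intro C _ hC f g hfg
  have h := nil2_iff.1 hC
  have h1 := hfg _ hr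
  have h2 := hfg _ hs
  rw [map_pow, map_pow] at h1 h2
  rw [map_pow, map_pow, map_commutatorElement, map_commutatorElement, ← comm_pow_left h, h1,
    comm_pow_left h, ← comm_pow_right h, h2, comm_pow_right h]

theorem construction {G : Type u} [Group G] (hG : IsNil2 G) (hac : IsAbsolutelyClosed G)
    {D : Type} [AddCommGroup D] (χ ψ : Additive G →+ D) (w : D) (x y : G) (n : ℕ) (hn0 : n ≠ 0)
    (hx : ∀ g, g * x = x * g) (hy : ∀ g, g * y = y * g)
    (hχy : χ (.ofMul y) = 0) (hψx : ψ (.ofMul x) = 0)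
    (hχx : χ (.ofMul x) = n • w) (hψy : ψ (.ofMul y) = - (n • w))
    (hχ : ∀ g, n • χ g = 0) (hψ : ∀ g, n • ψ g = 0) : n • w = 0 := by
  have hχ' : ∀ g, (n : ℤ) • χ g = 0 := by simpa using hχ
  have hψ' : ∀ g, (n : ℤ) • ψ g = 0 := by simpa using hψ
  let N := Ext2.rel χ ψ w x y n (hy x) hχy hψx hχx hψ
  have hNn : N.Normal := by
    constructor
    rintro _ ⟨a, b, rfl⟩ q
    have : ∀ u : Ext2 χ ψ w, u = ⟨x ^ (-a) * y ^ (-b), 0, n * a, n * b⟩ → q * u = u * q := by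
      rintro _ rfl
      ext
      · have h1 : Commute q.g x := hx _
        have h2 : Commute q.g y := hy _
        exact ((h1.zpow_right _).mul_right (h2.zpow_right _)).eq
      · simp only [Ext2.mul_c, ofMul_mul, ofMul_zpow, map_add, map_zsmul, hχy, hψx, hχx, hψy]
        have e1 : ((n:ℤ) * b) • χ (.ofMul q.g) = b • ((n:ℤ) • χ (.ofMul q.g)) := by module
        have e2 : ((n:ℤ) * a) • ψ (.ofMul q.g) = a • ((n:ℤ) • ψ (.ofMul q.g)) := by module
        rw [e1, e2, hχ', hψ']
        module
      · simp [add_comm]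
      · simp [add_comm]
    rw [this _ rfl, mul_inv_cancel_right]
    exact ⟨a, b, rfl⟩
  have hE := Ext2.nil2 (χ := χ) (ψ := ψ) (w := w) (nil2_iff.1 hG)
  have hA : IsNil2 (Ext2 χ ψ w ⧸ N) := by
    rw [nil2_iff]
    intro a b c
    obtain ⟨a, rfl⟩ := QuotientGroup.mk'_surjective N a
    obtain ⟨b, rfl⟩ := QuotientGroup.mk'_surjective N b
    obtain ⟨c, rfl⟩ := QuotientGroup.mk'_surjective N c
    rw [← map_commutatorElement, ← map_mul, ← map_mul, hE]
  let ι : G →* Ext2 χ ψ w ⧸ N := (QuotientGroup.mk' N).comp (Ext2.inG χ ψ w)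
  have key : ∀ (g : G) (c : D), (⟨g, c, 0, 0⟩ : Ext2 χ ψ w) ∈ N → g = 1 ∧ c = 0 := by
    rintro g c ⟨a, b, h⟩
    have hi := congrArg Ext2.i h
    have hj := congrArg Ext2.j h
    have hg := congrArg Ext2.g h
    have hc := congrArg Ext2.c h
    simp [hn0] at hi hj
    subst hi hj
    exact ⟨by simpa using hg, hc⟩
  have hι : Function.Injective ι := by
    rw [injective_iff_map_eq_one]
    intro g hg
    have : Ext2.inG χ ψ w g ∈ N := (QuotientGroup.eq_one_iff _).1 hg
    exact (key g 0 this).1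
  have hdom := hac _ hA ι hι
  let r : Ext2 χ ψ w := ⟨1, 0, 1, 0⟩
  let s : Ext2 χ ψ w := ⟨1, 0, 0, 1⟩
  have hr : ∀ k : ℕ, r ^ k = ⟨1, 0, k, 0⟩ := by
    intro k
    induction k with
    | zero => rfl
    | succ k ih => rw [pow_succ, ih]; ext <;> simp [r]
  have hs : ∀ k : ℕ, s ^ k = ⟨1, 0, 0, k⟩ := by
    intro k
    induction k with
    | zero => rfl
    | succ k ih => rw [pow_succ, ih]; ext <;> simp [s]
  have hz : ∀ k : ℕ, (⟨1, w, 0, 0⟩ : Ext2 χ ψ w) ^ k = ⟨1, k • w, 0, 0⟩ := by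
    intro k
    induction k with
    | zero => ext <;> simp
    | succ k ih => rw [pow_succ, ih]; ext <;> simp [add_smul]
  have hrs : ⁅r, s⁆ = ⟨1, w, 0, 0⟩ := by
    rw [commutatorElement_def, mul_inv_eq_iff_eq_mul, mul_inv_eq_iff_eq_mul]
    ext <;> simp [r, s]
  have hmem := mem_dominion ι.range (QuotientGroup.mk' N r) (QuotientGroup.mk' N s) n
    ⟨x, by
      rw [← map_pow, hr]
      refine (QuotientGroup.eq).2 ⟨1, 0, ?_⟩
      ext <;> simp [Ext2.inG, hψx, hχx]⟩
    ⟨y, by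
      rw [← map_pow, hs]
      refine (QuotientGroup.eq).2 ⟨0, 1, ?_⟩
      ext <;> simp [Ext2.inG, hχy]⟩
  rw [hdom, ← map_commutatorElement, ← map_pow, hrs, hz] at hmem
  obtain ⟨g, hg⟩ := hmem
  have : (Ext2.inG χ ψ w g)⁻¹ * ⟨1, n • w, 0, 0⟩ ∈ N := (QuotientGroup.eq).1 hg
  have h2 : (Ext2.inG χ ψ w g)⁻¹ * ⟨1, n • w, 0, 0⟩ = ⟨g⁻¹, n • w, 0, 0⟩ := by
    ext <;> simp [Ext2.inG]
  rw [h2] at this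
  exact (key _ _ this).2

theorem exists_characters {H : Type*} [CommGroup H] [Finite H] (hc : ¬ IsCyclic H) :
    ∃ (x y : H) (χ ψ : Additive H →+ AddCircle (1 : ℚ)) (t : AddCircle (1 : ℚ)), t ≠ 0 ∧
      χ (.ofMul x) = t ∧ χ (.ofMul y) = 0 ∧ ψ (.ofMul x) = 0 ∧ ψ (.ofMul y) = -t := by
  classical
  obtain ⟨ι, _, n, hn, ⟨e⟩⟩ := CommGroup.equiv_prod_multiplicative_zmod_of_finite H
  have hp : ¬ Pairwise (Function.onFun Nat.Coprime n) := by
    intro hp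
    apply hc
    let e2 := ZMod.prodEquivPi n hp
    let f : Multiplicative (ZMod (∏ i, n i)) →* H :=
      { toFun := fun z => e.symm (fun i => Multiplicative.ofAdd (e2 z.toAdd i))
        map_one' := by
          rw [← map_one e.symm]; congr 1; ext i; simp
        map_mul' := by
          intro a b
          rw [← map_mul e.symm]; congr 1; ext i; simp }
    refine isCyclic_of_surjective f ?_
    intro h
    refine ⟨Multiplicative.ofAdd (e2.symm (fun i => (e h i).toAdd)), ?_⟩
    simp [f]
  simp only [Pairwise, Function.onFun, not_forall] at hp
  obtain ⟨i, j, hij, hco⟩ := hp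
  set d := Nat.gcd (n i) (n j) with hd
  have hd1 : d ≠ 1 := hco
  have : Nontrivial (ZMod d) := ZMod.nontrivial_iff.2 hd1
  obtain ⟨c, hc1⟩ := CharacterModule.exists_character_apply_ne_zero_of_ne_zero
    (one_ne_zero : (1 : ZMod d) ≠ 0)
  let pr : ∀ k, d ∣ n k → Additive H →+ AddCircle (1 : ℚ) := fun k hk =>
    { toFun := fun h => c (ZMod.castHom hk (ZMod d) (e h.toMul k).toAdd)
      map_zero' := by simp
      map_add' := by intro a b; simp only [toMul_add, map_mul, Pi.mul_apply, toAdd_mul, map_add] }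
  have hi : d ∣ n i := Nat.gcd_dvd_left _ _
  have hj : d ∣ n j := Nat.gcd_dvd_right _ _
  let b : ι → H := fun k => e.symm (Pi.mulSingle k (Multiplicative.ofAdd 1))
  have h1 : ∀ k hk, pr k hk (.ofMul (b k)) = c 1 := by
    intro k hk
    simp only [pr, b, AddMonoidHom.coe_mk, ZeroHom.coe_mk, toMul_ofMul, MulEquiv.apply_symm_apply,
      Pi.mulSingle_eq_same, toAdd_ofAdd, map_one]
  have h2 : ∀ k l hk, k ≠ l → pr k hk (.ofMul (b l)) = 0 := by
    intro k l hk hkl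
    simp only [pr, b, AddMonoidHom.coe_mk, ZeroHom.coe_mk, toMul_ofMul, MulEquiv.apply_symm_apply,
      Pi.mulSingle_eq_of_ne hkl, toAdd_one, map_zero]
  refine ⟨b i, b j, pr i hi, -pr j hj, c 1, hc1, h1 _ _, h2 _ _ _ hij, ?_, ?_⟩
  · rw [AddMonoidHom.neg_apply, h2 _ _ _ (Ne.symm hij), neg_zero]
  · rw [AddMonoidHom.neg_apply, h1]

theorem extend_character {H K : Type*} [CommGroup H] [CommGroup K] (f : H →* K)
    (hf : Function.Injective f) (χ : Additive H →+ AddCircle (1 : ℚ)) :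
    ∃ χ' : Additive K →+ AddCircle (1 : ℚ), ∀ h, χ' (.ofMul (f h)) = χ (.ofMul h) := by
  obtain ⟨χ', h⟩ := CharacterModule.dual_surjective_of_injective (R := ℤ)
    (f.toAdditive.toIntLinearMap) (fun a b hab => hf hab) χ
  exact ⟨χ', fun g => DFunLike.congr_fun h (Additive.ofMul g)⟩

/-- If a finitely generated torsion nil-2 group is absolutely closed in `N₂`, then
`Z(G)/[G,G]` is cyclic. -/
theorem center_quotient_cyclic_of_absolutelyClosed {G : Type u} [Group G]
    (hG : IsNil2 G) (hfg : Group.FG G) (htor : ∀ g : G, IsOfFinOrder g)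
    (hac : IsAbsolutelyClosed G) :
    IsCyclic (↥(Subgroup.center G) ⧸ (commutator G).subgroupOf (Subgroup.center G)) := by
  by_contra hcyc
  let H := ↥(Subgroup.center G) ⧸ (commutator G).subgroupOf (Subgroup.center G)
  let _ : CommGroup H :=
    { QuotientGroup.Quotient.group ((commutator G).subgroupOf (Subgroup.center G)) with
      mul_comm := by
        intro a b
        obtain ⟨a, rfl⟩ := QuotientGroup.mk_surjective a
        obtain ⟨b, rfl⟩ := QuotientGroup.mk_surjective b
        exact congrArg QuotientGroup.mk (Subtype.ext (Subgroup.mem_center_iff.1 b.2 a)) }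
  have hsurj : Function.Surjective (Abelianization.of (G := G)) := QuotientGroup.mk'_surjective _
  have : Group.FG (Abelianization G) := Group.fg_of_surjective hsurj
  have hfin : Finite (Abelianization G) := by
    apply CommGroup.finite_of_fg_isMulTorsion
    intro a
    obtain ⟨g, rfl⟩ := hsurj a
    exact MonoidHom.isOfFinOrder _ (htor g)
  let φ : H →* Abelianization G :=
    QuotientGroup.map _ (commutator G) (Subgroup.center G).subtype le_rfl
  have hφ : Function.Injective φ := by
    rw [injective_iff_map_eq_one]
    intro a
    obtain ⟨a, rfl⟩ := QuotientGroup.mk_surjective a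
    intro ha
    have : (a : G) ∈ commutator G := (QuotientGroup.eq_one_iff _).1 ha
    exact (QuotientGroup.eq_one_iff _).2 this
  have : Finite H := Finite.of_injective φ hφ
  obtain ⟨x, y, χ, ψ, t, ht, h1, h2, h3, h4⟩ := exists_characters (H := H) hcyc
  obtain ⟨χ', hχ'⟩ := extend_character φ hφ χ
  obtain ⟨ψ', hψ'⟩ := extend_character φ hφ ψ
  obtain ⟨x, rfl⟩ := QuotientGroup.mk_surjective x
  obtain ⟨y, rfl⟩ := QuotientGroup.mk_surjective y
  let n := Monoid.exponent (Abelianization G)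
  have hn : n ≠ 0 := Monoid.exponent_ne_zero_of_finite
  let w : AddCircle (1 : ℚ) := DivisibleBy.div t (n : ℤ)
  have hw : n • w = t := by
    rw [← natCast_zsmul]
    exact DivisibleBy.div_cancel t (Int.natCast_ne_zero.2 hn)
  have hexp : ∀ (θ : Additive (Abelianization G) →+ AddCircle (1 : ℚ)) a, n • θ a = 0 := by
    intro θ a
    rw [← map_nsmul]
    have : n • a = 0 := Monoid.pow_exponent_eq_one (G := Abelianization G) a.toMul
    rw [this, map_zero]
  apply ht
  rw [← hw]
  let q : Additive G →+ Additive (Abelianization G) := (Abelianization.of (G := G)).toAdditive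
  refine construction hG hac (χ'.comp q) (ψ'.comp q) w x y n hn
    (Subgroup.mem_center_iff.1 x.2) (Subgroup.mem_center_iff.1 y.2) ?_ ?_ ?_ ?_
    (fun g => hexp _ _) (fun g => hexp _ _)
  · exact (hχ' _).trans h2
  · exact (hψ' _).trans h3
  · exact ((hχ' _).trans h1).trans hw.symm
  · exact ((hψ' _).trans h4).trans (by rw [hw])
end

section
/- Let G be a group of nilpotency class at most 2 (not necessarily abelian). If for every prime p the quotient of G by the subgroup generated by all p-th powers together with the commutator subgroup [G,G] is cyclic, then G is absolutely closed in N₂. -/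
universe u

theorem bez (i j : ℤ) : ∃ g a b u v : ℤ, i = g * a ∧ j = g * b ∧ u * a + v * b = 1 := by
  by_cases h : i = 0 ∧ j = 0
  · exact ⟨0, 1, 0, 1, 0, by simp [h.1], by simp [h.2], by simp⟩
  · have hg : 0 < Int.gcd i j := by
      rw [Nat.pos_iff_ne_zero, Ne, Int.gcd_eq_zero_iff]; exact h
    obtain ⟨a, b, hc, ha, hb⟩ := Int.exists_gcd_one hg
    obtain ⟨u, v, huv⟩ := Int.isCoprime_iff_gcd_eq_one.mpr hc
    exact ⟨Int.gcd i j, a, b, u, v, by rw [mul_comm]; exact ha, by rw [mul_comm]; exact hb, huv⟩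

theorem local_beta {ι : Type} [Finite ι] [LinearOrder ι] {P M : Type*} [AddCommGroup P] [AddCommGroup M]
    (b : Module.Basis ι ℤ P) (F : Submodule ℤ P) (ω : P →ₗ[ℤ] P →ₗ[ℤ] M)
    (halt : ∀ x, ω x x = 0)
    (hq : ∀ (q : ℤ) x y, q • x ∈ F → q • y ∈ F → q • ω x y = 0) :
    ∃ β : P →ₗ[ℤ] P →ₗ[ℤ] M, (∀ x ∈ F, β x = 0) ∧ ∀ x y, β x y - β y x = ω x y := by
  have hanti : ∀ x y, ω x y = - ω y x := by
    intro x y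
    have := halt (x + y)
    simp only [map_add, LinearMap.add_apply, halt, zero_add, add_zero] at this
    rw [add_comm] at this
    exact eq_neg_of_add_eq_zero_left this
  obtain ⟨n, S⟩ := Submodule.smithNormalForm b F
  obtain ⟨e, bN, f, a, snf⟩ := S
  classical
  obtain ⟨d, hd⟩ : ∃ d : ι → ℤ, (∀ k, d (f k) = a k) ∧ ∀ i, d i • e i ∈ F := by
    refine ⟨fun i => if h : ∃ k, f k = i then a h.choose else 0, ?_, ?_⟩
    · intro k
      have h : ∃ k', f k' = f k := ⟨k, rfl⟩
      simp only [h, dif_pos]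
      rw [f.injective h.choose_spec]
    · intro i
      by_cases h : ∃ k, f k = i
      · simp only [h, dif_pos]
        have := snf h.choose
        rw [h.choose_spec] at this
        rw [← this]; exact (bN _).2
      · simp only [h, dif_neg, not_false_iff, zero_smul, F.zero_mem]
  have hp : ∀ i j, ∃ p : M, d i • p = 0 ∧ d j • (p - ω (e i) (e j)) = 0 := by
    intro i j
    obtain ⟨g, s, t, u, v, hi, hj, h1⟩ := bez (d i) (d j)
    have h0 : (g * s * t) • ω (e i) (e j) = 0 := by
      apply hq
      · rw [← hi, mul_comm, mul_smul]; exact F.smul_mem _ (hd.2 i)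
      · rw [mul_right_comm, ← hj, mul_comm, mul_smul]; exact F.smul_mem _ (hd.2 j)
    refine ⟨(v * t) • ω (e i) (e j), ?_, ?_⟩
    · rw [hi, smul_smul, show g * s * (v * t) = v * (g * s * t) by ring, mul_smul, h0, smul_zero]
    · have : (v * t) • ω (e i) (e j) - ω (e i) (e j) = (-(u * s)) • ω (e i) (e j) := by
        rw [show -(u * s) = v * t - 1 by linarith, sub_smul, one_smul]
      rw [this, hj, smul_smul, show g * t * (-(u * s)) = (-u) * (g * s * t) by ring, mul_smul, h0,
        smul_zero]
  choose p hp1 hp2 using hp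
  let c : ι → ι → M := fun i j => if i < j then p i j else if j < i then p j i - ω (e j) (e i) else 0
  have hc1 : ∀ i j, d i • c i j = 0 := by
    intro i j
    simp only [c]
    split_ifs
    · exact hp1 _ _
    · exact hp2 _ _
    · simp
  have hc2 : ∀ i j, c i j - c j i = ω (e i) (e j) := by
    intro i j
    simp only [c]
    rcases lt_trichotomy i j with h | h | h
    · simp [h, h.not_gt]
    · subst h; simp [halt]
    · simp only [h, h.not_gt, if_true, if_false]; rw [hanti (e i)]; abel
  refine ⟨e.constr ℤ (fun i => e.constr ℤ (fun j => c i j)), ?_, ?_⟩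
  · intro x hx
    set β := e.constr ℤ (fun i => e.constr ℤ (fun j => c i j)) with hβ
    have : β.comp F.subtype = 0 := by
      apply bN.ext
      intro k
      simp only [LinearMap.comp_apply, Submodule.subtype_apply, snf, LinearMap.zero_apply]
      apply e.ext
      intro j
      rw [map_smul, hβ, Module.Basis.constr_basis, LinearMap.smul_apply, Module.Basis.constr_basis, ← hd.1, hc1]
      rfl
    exact LinearMap.congr_fun this ⟨x, hx⟩
  · set β := e.constr ℤ (fun i => e.constr ℤ (fun j => c i j)) with hβ
    have : β - β.flip = ω := by
      apply e.ext; intro i; apply e.ext; intro j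
      simp only [LinearMap.sub_apply, LinearMap.flip_apply, hβ, Module.Basis.constr_basis, hc2]
    intro x y
    rw [← this]; rfl

theorem fin_beta {E M : Type*} [AddCommGroup E] [AddCommGroup M]
    (F : AddSubgroup E) (ω : E →+ E →+ M) (halt : ∀ x, ω x x = 0)
    (hq : ∀ (q : ℤ) x y, q • x ∈ F → q • y ∈ F → q • ω x y = 0) (S : Finset E) :
    ∃ b : E → E → M, ∀ x ∈ S, ∀ y ∈ S, ∀ z ∈ S, b (x + y) z = b x z + b y z ∧
      b z (x + y) = b z x + b z y ∧ b x y - b y x = ω x y ∧ (x ∈ F → b x y = 0) := by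
  classical
  let v : Fin S.card → E := fun k => (S.equivFin.symm k : E)
  let π : (Fin S.card → ℤ) →ₗ[ℤ] E := Fintype.linearCombination ℤ v
  have hπ : ∀ x ∈ S, ∃ p, π p = x := by
    intro x hx
    refine ⟨Pi.single (S.equivFin ⟨x, hx⟩) 1, ?_⟩
    simp [π, Fintype.linearCombination_apply_single, v]
  let Ω : (Fin S.card → ℤ) →ₗ[ℤ] (Fin S.card → ℤ) →ₗ[ℤ] M :=
    LinearMap.mk₂ ℤ (fun p r => ω (π p) (π r)) (by intros; simp) (by intro c m n; simp only [map_zsmul, AddMonoidHom.zsmul_apply])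
      (by intros; simp) (by intro c m n; simp only [map_zsmul])
  have hΩ : ∀ p r, Ω p r = ω (π p) (π r) := fun p r => rfl
  obtain ⟨β, h1, h2⟩ := local_beta (Pi.basisFun ℤ (Fin S.card))
    ((AddSubgroup.toIntSubmodule F).comap π) Ω (fun x => halt _) (by
      intro q x y hx hy
      have hx' : π (q • x) ∈ F := hx
      have hy' : π (q • y) ∈ F := hy
      rw [map_smul] at hx' hy'
      exact hq q _ _ hx' hy')
  have k1 : ∀ p, π p ∈ F → β p = 0 := fun p hp => h1 p hp
  have k2 : ∀ p r, π r = 0 → β p r = 0 := by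
    intro p r hr
    have := h2 p r
    rw [k1 r (by rw [hr]; exact F.zero_mem), hΩ, hr] at this
    simpa using this
  have k3 : ∀ p p' r r', π p = π p' → π r = π r' → β p r = β p' r' := by
    intro p p' r r' hp hr
    have e1 : β (p - p') = 0 := k1 _ (by rw [map_sub, hp, sub_self]; exact F.zero_mem)
    have e2 : β p' (r - r') = 0 := k2 _ _ (by rw [map_sub, hr, sub_self])
    rw [map_sub, sub_eq_zero] at e1 e2
    rw [e1, e2]
  let l : E → (Fin S.card → ℤ) := fun x => if h : ∃ p, π p = x then h.choose else 0
  have hl : ∀ x, (∃ p, π p = x) → π (l x) = x := by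
    intro x h
    simp only [l, h, dif_pos]
    exact h.choose_spec
  refine ⟨fun x y => β (l x) (l y), ?_⟩
  intro x hx y hy z hz
  have hx := hl x (hπ x hx)
  have hy := hl y (hπ y hy)
  have hz := hl z (hπ z hz)
  have hxy : π (l (x + y)) = π (l x + l y) := by
    rw [hl _ ⟨l x + l y, by rw [map_add, hx, hy]⟩, map_add, hx, hy]
  refine ⟨?_, ?_, ?_, ?_⟩
  · simp only []
    rw [k3 _ _ _ _ hxy rfl, map_add, LinearMap.add_apply]
  · simp only []
    rw [k3 _ _ _ _ rfl hxy, map_add]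
  · simp only []
    rw [h2, hΩ, hx, hy]
  · intro h
    simp only []
    rw [k1 _ (by rw [hx]; exact h)]; rfl

theorem global_beta {E M : Type*} [AddCommGroup E] [AddCommGroup M] [TopologicalSpace M]
    [IsTopologicalAddGroup M] [CompactSpace M] [T2Space M]
    (F : AddSubgroup E) (ω : E →+ E →+ M) (halt : ∀ x, ω x x = 0)
    (hq : ∀ (q : ℤ) x y, q • x ∈ F → q • y ∈ F → q • ω x y = 0) :
    ∃ b : E → E → M, (∀ x y z, b (x + y) z = b x z + b y z) ∧
      (∀ x y z, b z (x + y) = b z x + b z y) ∧ (∀ x y, b x y - b y x = ω x y) ∧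
      (∀ x y, x ∈ F → b x y = 0) := by
  classical
  let K : Finset E → Set (E → E → M) := fun S => {b | ∀ x ∈ S, ∀ y ∈ S, ∀ z ∈ S,
      b (x + y) z = b x z + b y z ∧
      b z (x + y) = b z x + b z y ∧ b x y - b y x = ω x y ∧ (x ∈ F → b x y = 0)}
  have hcl : ∀ S, IsClosed (K S) := by
    intro S
    have hc : ∀ x y : E, Continuous (fun b : E → E → M => b x y) := by
      intro x y; fun_prop
    simp only [K, Set.ofPred_forall, Set.ofPred_and]
    refine isClosed_iInter fun x => isClosed_iInter fun _ => isClosed_iInter fun y =>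
      isClosed_iInter fun _ => isClosed_iInter fun z => isClosed_iInter fun _ => ?_
    refine IsClosed.inter ?_ (IsClosed.inter ?_ (IsClosed.inter ?_ ?_))
    · exact isClosed_eq (hc _ _) ((hc _ _).add (hc _ _))
    · exact isClosed_eq (hc _ _) ((hc _ _).add (hc _ _))
    · exact isClosed_eq ((hc _ _).sub (hc _ _)) continuous_const
    · exact isClosed_iInter fun _ => isClosed_eq (hc _ _) continuous_const
  have hmono : ∀ S T, S ⊆ T → K T ⊆ K S := by
    intro S T h b hb x hx y hy z hz
    exact hb x (h hx) y (h hy) z (h hz)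
  obtain ⟨b, hb⟩ := IsCompact.nonempty_iInter_of_directed_nonempty_isCompact_isClosed K
    (fun S T => ⟨S ∪ T, hmono _ _ Finset.subset_union_left, hmono _ _ Finset.subset_union_right⟩)
    (fun S => fin_beta F ω halt hq S) (fun S => (hcl S).isCompact) hcl
  rw [Set.mem_iInter] at hb
  have key : ∀ x y z, _ := fun x y z => hb {x, y, z} x (by simp) y (by simp) z (by simp)
  exact ⟨b, fun x y z => (key x y z).1, fun x y z => (key x y z).2.1,
    fun x y => (key x y 0).2.2.1, fun x y => (key x y 0).2.2.2⟩

theorem q_kill {E M : Type*} [AddCommGroup E] [AddCommGroup M]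
    (F : AddSubgroup E) (ω : E →+ E →+ M) (halt : ∀ x, ω x x = 0)
    (hF : ∀ x ∈ F, ∀ y ∈ F, ω x y = 0)
    (hcyc : ∀ q : ℤ, q ≠ 0 → ∃ g ∈ F, ∀ x ∈ F, ∃ i : ℤ, ∃ m ∈ F, x = i • g + q • m)
    (q : ℤ) (x y : E) (hx : q • x ∈ F) (hy : q • y ∈ F) : q • ω x y = 0 := by
  by_cases hq0 : q = 0
  · simp [hq0]
  obtain ⟨g, hg, hc⟩ := hcyc q hq0
  obtain ⟨i, m, hm, hi⟩ := hc _ hx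
  obtain ⟨j, n, hn, hj⟩ := hc _ hy
  have hanti : ∀ x y, ω x y = - ω y x := by
    intro x y
    have := halt (x + y)
    simp only [map_add, AddMonoidHom.add_apply, halt, zero_add, add_zero] at this
    rw [add_comm] at this
    exact eq_neg_of_add_eq_zero_left this
  obtain ⟨x', rfl⟩ : ∃ x', x = x' + m := ⟨x - m, by abel⟩
  obtain ⟨y', rfl⟩ : ∃ y', y = y' + n := ⟨y - n, by abel⟩
  have hx' : q • x' = i • g := by rw [smul_add] at hi; exact add_right_cancel hi
  have hy' : q • y' = j • g := by rw [smul_add] at hj; exact add_right_cancel hj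
  have e1 : q • ω x' n = 0 := by
    rw [← AddMonoidHom.zsmul_apply, ← map_zsmul, hx', map_zsmul, AddMonoidHom.zsmul_apply,
      hF g hg n hn, smul_zero]
  have e2 : q • ω m y' = 0 := by
    rw [← map_zsmul, hy', map_zsmul, hF m hm g hg, smul_zero]
  obtain ⟨d, a, b, u, v, hia, hjb, h1⟩ := bez i j
  have e3 : q • ω (u • x' + v • y') ((-b) • x' + a • y') = 0 := by
    have : q • ((-b) • x' + a • y') = 0 := by
      rw [smul_add, smul_comm q (-b), hx', smul_comm q a, hy', smul_smul, smul_smul, ← add_smul, hia, hjb]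
      rw [show -b * (d * a) + a * (d * b) = 0 by ring, zero_smul]
    rw [← map_zsmul, this, map_zero]
  have e4 : ω (u • x' + v • y') ((-b) • x' + a • y') = ω x' y' := by
    simp only [map_add, map_zsmul, AddMonoidHom.add_apply, AddMonoidHom.zsmul_apply, halt, hanti y' x']
    conv_rhs => rw [← one_smul ℤ (ω x' y'), ← h1]
    module
  rw [e4] at e3
  simp only [map_add, AddMonoidHom.add_apply, smul_add, e1, e2, e3, hF m hm n hn, add_zero]

theorem cyc_all {E : Type*} [AddCommGroup E] (F : AddSubgroup E)
    (hp : ∀ p : ℕ, p.Prime → ∃ g ∈ F, ∀ x ∈ F, ∃ i : ℤ, ∃ m ∈ F, x = i • g + (p : ℤ) • m)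
    (q : ℤ) (hq : q ≠ 0) : ∃ g ∈ F, ∀ x ∈ F, ∃ i : ℤ, ∃ m ∈ F, x = i • g + q • m := by
  have key : ∀ n : ℕ, n ≠ 0 → ∃ g ∈ F, ∀ x ∈ F, ∃ i : ℤ, ∃ m ∈ F, x = i • g + (n : ℤ) • m := by
    intro n
    induction n using Nat.recOnPosPrimePosCoprime with
    | prime_pow p n hpp hn =>
      intro _
      obtain ⟨g, hg, h⟩ := hp p hpp
      refine ⟨g, hg, ?_⟩
      clear hn
      induction n with
      | zero => exact fun x hx => ⟨0, x, hx, by simp⟩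
      | succ k ih =>
        intro x hx
        obtain ⟨i, m, hm, e⟩ := ih (by exact pow_ne_zero _ hpp.ne_zero) x hx
        obtain ⟨j, r, hr, e'⟩ := h m hm
        refine ⟨i + (p : ℤ) ^ k * j, r, hr, ?_⟩
        rw [e, e']
        push_cast
        module
    | zero => exact fun h => absurd rfl h
    | one => exact fun _ => ⟨0, F.zero_mem, fun x hx => ⟨0, x, hx, by simp⟩⟩
    | coprime a b ha hb hab iha ihb =>
      intro _
      obtain ⟨g, hg, h⟩ := iha (by omega)
      obtain ⟨g', hg', h'⟩ := ihb (by omega)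
      obtain ⟨u, v, huv⟩ := Nat.isCoprime_iff_coprime.mpr hab
      refine ⟨(v * b) • g + (u * a) • g', F.add_mem (F.zsmul_mem hg _) (F.zsmul_mem hg' _), ?_⟩
      intro x hx
      obtain ⟨i, m, hm, e⟩ := h x hx
      obtain ⟨j, n, hn, e'⟩ := h' x hx
      refine ⟨v * b * i + u * a * j, v • m + u • n + (u * v * (i - j)) • (g - g'),
        F.add_mem (F.add_mem (F.zsmul_mem hm _) (F.zsmul_mem hn _))
          (F.zsmul_mem (F.sub_mem hg hg') _), ?_⟩
      have c1 : v * b * i = (v * b * i + u * a * j) * (v * b) + a * b * (u * v * (i - j)) := by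
        linear_combination (-(v * b * i)) * huv
      have c2 : u * a * j = (v * b * i + u * a * j) * (u * a) - a * b * (u * v * (i - j)) := by
        linear_combination (-(u * a * j)) * huv
      have e3 : x = (v * b * i) • g + (u * a * j) • g' + (a * b : ℤ) • (v • m + u • n) := by
        calc x = (u * a + v * b) • x := by rw [huv, one_smul]
          _ = (u * a) • x + (v * b) • x := add_smul _ _ _
          _ = (u * a) • (j • g' + (b : ℤ) • n) + (v * b) • (i • g + (a : ℤ) • m) := by
            rw [← e, ← e']
          _ = _ := by module
      have c1' : ∀ z : E, (v * b * i) • z =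
          ((v * b * i + u * a * j) * (v * b) + a * b * (u * v * (i - j))) • z := fun z => by
        conv_lhs => rw [c1]
      have c2' : ∀ z : E, (u * a * j) • z =
          ((v * b * i + u * a * j) * (u * a) - a * b * (u * v * (i - j))) • z := fun z => by
        conv_lhs => rw [c2]
      rw [e3, c1' g, c2' g']
      push_cast
      module
  obtain ⟨g, hg, h⟩ := key q.natAbs (by simpa using hq)
  refine ⟨g, hg, fun x hx => ?_⟩
  obtain ⟨i, m, hm, e⟩ := h x hx
  rcases Int.natAbs_eq q with h | h
  · exact ⟨i, m, hm, by rw [h]; exact e⟩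
  · exact ⟨i, -m, F.neg_mem hm, by rw [h, smul_neg, neg_smul, neg_neg]; exact e⟩
open scoped commutatorElement


noncomputable instance circleDiv : DivisibleBy (Additive Circle) ℤ :=
  AddCommGroup.divisibleByIntOfSMulTopEqTop (Additive Circle) (by
    intro n hn
    rw [eq_top_iff]
    rintro z -
    obtain ⟨t, ht⟩ := Circle.exp_surjective z.toMul
    refine ⟨Additive.ofMul (Circle.exp (t / n)), trivial, ?_⟩
    apply Additive.toMul.injective
    rw [← ht]
    change (Circle.exp (t / n)) ^ n = _
    rw [← Circle.exp_intCast_mul]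
    congr 1
    field_simp)

theorem circle_ext {V W : Type*} [CommGroup V] [CommGroup W] (i : W →* V)
    (hi : Function.Injective i) (χ : W →* Circle) : ∃ r : V →* Circle, ∀ w, r (i w) = χ w := by
  obtain ⟨h, hh⟩ := (Module.Baer.of_divisible (Additive Circle)).extension_property_addMonoidHom
    (MonoidHom.toAdditive i) hi (MonoidHom.toAdditive χ)
  exact ⟨MonoidHom.toAdditive.symm h, fun w => DFunLike.congr_fun hh (Additive.ofMul w)⟩

noncomputable def ratCircle : AddCircle (1 : ℚ) →+ Additive Circle :=
  QuotientAddGroup.lift _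
    ({ toFun := fun q : ℚ => Additive.ofMul (Circle.exp (q * (2 * Real.pi)))
       map_zero' := by simp
       map_add' := fun x y => by
        rw [← ofMul_mul, ← Circle.exp_add]; push_cast; rw [add_mul] } : ℚ →+ Additive Circle)
    (by
      intro x hx
      obtain ⟨n, rfl⟩ := AddSubgroup.mem_zmultiples_iff.mp hx
      change Additive.ofMul (Circle.exp _) = Additive.ofMul 1
      congr 1
      rw [Circle.exp_eq_one]
      exact ⟨n, by simp⟩)

theorem ratCircle_inj (x : AddCircle (1 : ℚ)) (h : ratCircle x = 0) : x = 0 := by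
  obtain ⟨q, rfl⟩ := QuotientAddGroup.mk_surjective x
  have h' : Circle.exp (q * (2 * Real.pi)) = 1 := h
  rw [Circle.exp_eq_one] at h'
  obtain ⟨n, hn⟩ := h'
  have : (q : ℝ) = n := mul_right_cancel₀ (by positivity) hn
  have : q = n := by exact_mod_cast this
  rw [QuotientAddGroup.eq_zero_iff, this]
  exact AddSubgroup.mem_zmultiples_iff.mpr ⟨n, by simp⟩

theorem circle_sep {V : Type*} [CommGroup V] (H : Subgroup V) (v : V) (hv : v ∉ H) :
    ∃ χ : V →* Circle, (∀ x ∈ H, χ x = 1) ∧ χ v ≠ 1 := by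
  have h0 : Additive.ofMul (QuotientGroup.mk v : V ⧸ H) ≠ 0 := by
    intro h
    exact hv ((QuotientGroup.eq_one_iff v).mp h)
  obtain ⟨c, hc⟩ := CharacterModule.exists_character_apply_ne_zero_of_ne_zero h0
  let c' : Additive (V ⧸ H) →+ AddCircle (1 : ℚ) := c
  refine ⟨(MonoidHom.toAdditive.symm (ratCircle.comp c') : V ⧸ H →* Circle).comp
    (QuotientGroup.mk' H), ?_, ?_⟩
  · intro x hx
    have : QuotientGroup.mk' H x = 1 := (QuotientGroup.eq_one_iff x).mpr hx
    rw [MonoidHom.comp_apply, this, map_one]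
  · intro h
    exact hc (ratCircle_inj _ h)

/-- twisted product used as the test group -/
structure TestGrp (A : Type*) [Group A] where
  x : A
  s : A →* Circle
  m : Circle

namespace TestGrp
variable {A : Type*} [Group A]

@[ext] theorem ext' {p q : TestGrp A} (h1 : p.x = q.x) (h2 : p.s = q.s) (h3 : p.m = q.m) : p = q := by
  cases p; cases q; simp_all

noncomputable instance : Mul (TestGrp A) := ⟨fun p q => ⟨p.x * q.x, p.s * q.s, p.m * q.m * p.s q.x⟩⟩
noncomputable instance : One (TestGrp A) := ⟨⟨1, 1, 1⟩⟩
noncomputable instance : Inv (TestGrp A) := ⟨fun p => ⟨p.x⁻¹, p.s⁻¹, p.m⁻¹ * p.s p.x⟩⟩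

@[simp] theorem mul_x (p q : TestGrp A) : (p * q).x = p.x * q.x := rfl
@[simp] theorem mul_s (p q : TestGrp A) : (p * q).s = p.s * q.s := rfl
@[simp] theorem mul_m (p q : TestGrp A) : (p * q).m = p.m * q.m * p.s q.x := rfl
@[simp] theorem one_x : (1 : TestGrp A).x = 1 := rfl
@[simp] theorem one_s : (1 : TestGrp A).s = 1 := rfl
@[simp] theorem one_m : (1 : TestGrp A).m = 1 := rfl
@[simp] theorem inv_x (p : TestGrp A) : p⁻¹.x = p.x⁻¹ := rfl
@[simp] theorem inv_s (p : TestGrp A) : p⁻¹.s = p.s⁻¹ := rfl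
@[simp] theorem inv_m (p : TestGrp A) : p⁻¹.m = p.m⁻¹ * p.s p.x := rfl

noncomputable instance : Group (TestGrp A) := Group.ofLeftAxioms
  (by
    intro p q r
    ext1
    · simp [mul_assoc]
    · simp [mul_assoc]
    · simp only [mul_x, mul_s, mul_m, MonoidHom.mul_apply, map_mul]
      ac_rfl)
  (by intro p; ext1 <;> simp)
  (by intro p; ext1 <;> simp)

theorem nil2 (hA : IsNil2 A) : IsNil2 (TestGrp A) := by
  unfold IsNil2
  rw [commutator_def, Subgroup.commutator_le]
  intro p _ q _
  rw [Subgroup.mem_center_iff]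
  intro r
  have hx : ⁅p.x, q.x⁆ ∈ Subgroup.center A := hA (Subgroup.commutator_mem_commutator (Subgroup.mem_top _) (Subgroup.mem_top _))
  have e1 : ⁅p, q⁆.x = ⁅p.x, q.x⁆ := rfl
  have e2 : ⁅p, q⁆.s = 1 := by
    change p.s * q.s * p.s⁻¹ * q.s⁻¹ = 1
    rw [mul_comm p.s]; simp
  have e3 : r.s ⁅p.x, q.x⁆ = 1 := by
    rw [map_commutatorElement, commutatorElement_eq_one_iff_mul_comm, mul_comm]
  ext1
  · rw [mul_x, mul_x, e1]; exact Subgroup.mem_center_iff.mp hx _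
  · rw [mul_s, mul_s, e2, mul_one, one_mul]
  · rw [mul_m, mul_m, e2, e1, e3, mul_comm r.m]; simp

end TestGrp

theorem dom_phi {A : Type u} [Group A] (hA : IsNil2 A) (B : Subgroup A)
    (β : A →* A →* Circle) (φ : A → Circle) (hφ : ∀ x y, φ (x * y) = φ x * φ y * β x y)
    (hβB : ∀ b ∈ B, β b = 1) (hφB : ∀ b ∈ B, φ b = 1) (a : A) (ha : a ∈ Dominion B) :
    φ a = 1 := by
  have h1 : φ 1 = 1 := hφB 1 B.one_mem
  let f : A →* TestGrp A :=
    { toFun := fun x => ⟨x, 1, 1⟩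
      map_one' := rfl
      map_mul' := fun x y => by ext1 <;> simp }
  let g : A →* TestGrp A :=
    { toFun := fun x => ⟨x, β x, φ x⟩
      map_one' := by ext1 <;> simp [h1]
      map_mul' := fun x y => by ext1 <;> simp [hφ] }
  have := ha (TestGrp A) (TestGrp.nil2 hA) f g (by
    intro b hb
    ext1
    · rfl
    · exact (hβB b hb).symm
    · exact (hφB b hb).symm)
  exact (congrArg TestGrp.m this).symm

theorem exists_phi {A : Type u} [Group A] (hA : IsNil2 A) (B : Subgroup A)
    (β : A →* A →* Circle) (ψ : commutator A →* Circle)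
    (hψB : ∀ c : commutator A, (c : A) ∈ B → ψ c = 1) (hβB : ∀ b ∈ B, β b = 1)
    (hβψ : ∀ x y, β x y = ψ ⟨⁅x, y⁆, Subgroup.commutator_mem_commutator (Subgroup.mem_top _) (Subgroup.mem_top _)⟩ * β y x) :
    ∃ φ : A → Circle, (∀ x y, φ (x * y) = φ x * φ y * β x y) ∧ (∀ b ∈ B, φ b = 1) ∧
      ∀ c : commutator A, φ c = ψ c := by
  have hcen : ∀ c : commutator A, ∀ x : A, x * c = c * x := fun c x =>
    Subgroup.mem_center_iff.mp (hA c.2) x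
  have hβc : ∀ (c : commutator A), β c = 1 := by
    intro c
    have : commutator A ≤ β.ker := Abelianization.commutator_subset_ker β
    exact this c.2
  have hβc' : ∀ (x : A) (c : commutator A), β x c = 1 := by
    intro x c
    have : commutator A ≤ (β x).ker := Abelianization.commutator_subset_ker (β x)
    exact this c.2
  let X : Subgroup (TestGrp A) :=
    { carrier := {p | p.s = β p.x}
      one_mem' := by simp
      mul_mem' := by
        intro p q hp hq
        simp only [Set.mem_ofPred_eq] at *
        simp [hp, hq]
      inv_mem' := by
        intro p hp
        simp only [Set.mem_ofPred_eq] at *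
        simp [hp] }
  have hX : ∀ p : X, (p : TestGrp A).s = β (p : TestGrp A).x := fun p => p.2
  let K : Subgroup X :=
    { carrier := {p | ∃ c : commutator A, ∃ b ∈ B, (p : TestGrp A).x = c * b ∧ (p : TestGrp A).m = ψ c}
      one_mem' := ⟨1, 1, B.one_mem, by simp, by simp⟩
      mul_mem' := by
        rintro p q ⟨c, b, hb, h1, h2⟩ ⟨c', b', hb', h1', h2'⟩
        refine ⟨c * c', b * b', B.mul_mem hb hb', ?_, ?_⟩
        · change (p : TestGrp A).x * (q : TestGrp A).x = _
          rw [h1, h1']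
          simp only [Subgroup.coe_mul, mul_assoc]
          rw [← mul_assoc b, hcen c' b, mul_assoc]
        · change (p : TestGrp A).m * (q : TestGrp A).m * (p : TestGrp A).s (q : TestGrp A).x = _
          rw [hX, h1, map_mul, hβc, hβB b hb, h2, h2', map_mul]
          simp
      inv_mem' := by
        rintro p ⟨c, b, hb, h1, h2⟩
        refine ⟨c⁻¹, b⁻¹, B.inv_mem hb, ?_, ?_⟩
        · change (p : TestGrp A).x⁻¹ = _
          rw [h1, mul_inv_rev, hcen c⁻¹ b⁻¹ |>.symm]
          rfl
        · change (p : TestGrp A).m⁻¹ * (p : TestGrp A).s (p : TestGrp A).x = _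
          have : β (c * b) = 1 := by rw [map_mul, hβc, hβB b hb, mul_one]
          rw [hX, h1, this, h2, map_inv]
          simp }
  have hK : commutator X ≤ K := by
    rw [commutator_def, Subgroup.commutator_le]
    intro p _ q _
    let c : commutator A := ⟨⁅(p : TestGrp A).x, (q : TestGrp A).x⁆,
      Subgroup.commutator_mem_commutator (Subgroup.mem_top _) (Subgroup.mem_top _)⟩
    let k : X := ⟨⟨c, 1, ψ c⟩, (hβc c).symm⟩
    have hk : p * q = k * (q * p) := by
      apply Subtype.ext
      ext1
      · change (p : TestGrp A).x * (q : TestGrp A).x =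
          ⁅(p : TestGrp A).x, (q : TestGrp A).x⁆ * ((q : TestGrp A).x * (p : TestGrp A).x)
        rw [commutatorElement_def]; group
      · change (p : TestGrp A).s * (q : TestGrp A).s = 1 * ((q : TestGrp A).s * (p : TestGrp A).s)
        rw [one_mul, mul_comm]
      · change (p : TestGrp A).m * (q : TestGrp A).m * (p : TestGrp A).s (q : TestGrp A).x =
          ψ c * ((q : TestGrp A).m * (p : TestGrp A).m * (q : TestGrp A).s (p : TestGrp A).x) * 1
        rw [hX, hX, hβψ, mul_one]
        change _ * (ψ c * _) = _
        rw [mul_comm (p : TestGrp A).m]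
        ac_rfl
    have : ⁅p, q⁆ = k := by
      rw [commutatorElement_def, hk]; group
    rw [this]
    exact ⟨c, 1, B.one_mem, (mul_one _).symm, rfl⟩
  let L : Subgroup (Abelianization X) := K.map Abelianization.of
  have hL : ∀ p : X, Abelianization.of p ∈ L → p ∈ K := by
    rintro p ⟨k, hk, e⟩
    have : k⁻¹ * p ∈ commutator X := by
      rw [← Abelianization.ker_of, MonoidHom.mem_ker, map_mul, map_inv, e, inv_mul_cancel]
    have := K.mul_mem hk (hK this)
    simpa using this
  let π : X →* (Abelianization X ⧸ L) := (QuotientGroup.mk' L).comp Abelianization.of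
  have hπ : ∀ p, π p = 1 ↔ p ∈ K := by
    intro p
    constructor
    · intro h
      exact hL p ((QuotientGroup.eq_one_iff _).mp h)
    · intro h
      exact (QuotientGroup.eq_one_iff _).mpr ⟨p, h, rfl⟩
  let j : Circle →* X :=
    { toFun := fun m => ⟨⟨1, 1, m⟩, (map_one β).symm⟩
      map_one' := rfl
      map_mul' := fun m m' => by
        apply Subtype.ext
        ext1
        · exact (mul_one _).symm
        · exact (mul_one _).symm
        · exact (mul_one _).symm }
  have hj : Function.Injective (π.comp j) := by
    rw [injective_iff_map_eq_one]
    intro m hm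
    obtain ⟨c, b, hb, h1, h2⟩ := (hπ _).mp hm
    have h1 : (1 : A) = c * b := h1
    have h2 : m = ψ c := h2
    rw [h2]
    apply hψB
    rw [eq_inv_of_mul_eq_one_left h1.symm]
    exact B.inv_mem hb
  obtain ⟨r, hr⟩ := circle_ext (π.comp j) hj (MonoidHom.id Circle)
  let l : A → X := fun x => ⟨⟨x, β x, 1⟩, rfl⟩
  have hl : ∀ x y, l x * l y = l (x * y) * j (β x y) := by
    intro x y
    apply Subtype.ext
    ext1
    · exact (mul_one _).symm
    · change β x * β y = β (x * y) * 1
      rw [map_mul, mul_one]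
    · change (1 : Circle) * 1 * β x y = 1 * β x y * β (x * y) 1
      simp
  have hrj : ∀ m, r (π (j m)) = m := hr
  refine ⟨fun x => (r (π (l x)))⁻¹, ?_, ?_, ?_⟩
  · intro x y
    have := congrArg (fun z => r (π z)) (hl x y)
    simp only [map_mul, hrj] at this
    simp only []
    rw [← mul_inv, this]
    simp
  · intro b hb
    have : π (l b) = 1 := (hπ _).mpr ⟨1, b, hb, by simp [l], by simp [l]⟩
    simp [this]
  · intro c
    have h1 : l c * j (ψ c) ∈ K := by
      refine ⟨c, 1, B.one_mem, rfl, ?_⟩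
      change (1 : Circle) * ψ c * β c 1 = ψ c
      simp
    have := congrArg r ((hπ _).mpr h1)
    rw [map_mul, map_mul, hrj, map_one] at this
    exact inv_eq_of_mul_eq_one_right this

theorem comm_mul_left {A : Type*} [Group A] (hA : IsNil2 A) (x y z : A) :
    ⁅x * y, z⁆ = ⁅x, z⁆ * ⁅y, z⁆ := by
  have h : ⁅y, z⁆ ∈ Subgroup.center A := hA (Subgroup.commutator_mem_commutator (Subgroup.mem_top _) (Subgroup.mem_top _))
  have h' := Subgroup.mem_center_iff.mp h
  have : ⁅x * y, z⁆ = x * ⁅y, z⁆ * z * x⁻¹ * z⁻¹ := by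
    simp only [commutatorElement_def]; group
  rw [this, h' x]
  rw [mul_assoc, mul_assoc, mul_assoc, ← h' _]
  simp only [commutatorElement_def]; group

theorem comm_mul_right {A : Type*} [Group A] (hA : IsNil2 A) (x y z : A) :
    ⁅x, y * z⁆ = ⁅x, y⁆ * ⁅x, z⁆ := by
  rw [← commutatorElement_inv (y * z) x, comm_mul_left hA, mul_inv_rev, commutatorElement_inv,
    commutatorElement_inv]
  have h : ⁅x, y⁆ ∈ Subgroup.center A := hA (Subgroup.commutator_mem_commutator (Subgroup.mem_top _) (Subgroup.mem_top _))
  exact Subgroup.mem_center_iff.mp h _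

theorem exists_beta {A : Type u} [Group A] (hA : IsNil2 A) (B : Subgroup A)
    (ψ : commutator A →* Circle)
    (hψB : ∀ c : commutator A, (c : A) ∈ B → ψ c = 1)
    (hcyc : ∀ p : ℕ, p.Prime → ∃ g ∈ B, ∀ x ∈ B, ∃ i : ℤ, ∃ m ∈ B, ∃ c ∈ commutator A,
      x = g ^ i * m ^ p * c) :
    ∃ β : A →* A →* Circle, (∀ b ∈ B, β b = 1) ∧
    (∀ x y, β x y = ψ ⟨⁅x, y⁆, Subgroup.commutator_mem_commutator (Subgroup.mem_top _) (Subgroup.mem_top _)⟩ * β y x) := by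
  let w : A → A → Circle := fun x y =>
    ψ ⟨⁅x, y⁆, Subgroup.commutator_mem_commutator (Subgroup.mem_top _) (Subgroup.mem_top _)⟩
  have hwl : ∀ x y z, w (x * y) z = w x z * w y z := by
    intro x y z
    simp only [w]
    rw [← map_mul]
    congr 1
    exact Subtype.ext (comm_mul_left hA x y z)
  have hwr : ∀ x y z, w x (y * z) = w x y * w x z := by
    intro x y z
    simp only [w]
    rw [← map_mul]
    congr 1
    exact Subtype.ext (comm_mul_right hA x y z)
  let W : A →* A →* Circle :=
    MonoidHom.mk' (fun x => MonoidHom.mk' (fun y => w x y) (hwr x))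
      (fun x y => MonoidHom.ext (fun z => hwl x y z))
  let W' : A →* (Abelianization A →* Circle) :=
    MonoidHom.mk' (fun x => Abelianization.lift (W x)) (fun x y => by
      apply Abelianization.hom_ext
      ext z
      simp)
  let W2 : Abelianization A →* (Abelianization A →* Circle) := Abelianization.lift W'
  have hW2 : ∀ x y, W2 (Abelianization.of x) (Abelianization.of y) = w x y := by
    intro x y
    simp [W2, W', W]
  let E := Additive (Abelianization A)
  let ω : E →+ E →+ Additive Circle :=
    AddMonoidHom.mk' (fun x => MonoidHom.toAdditive (W2 x.toMul)) (fun x y => by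
      have h : W2 (x + y).toMul = W2 x.toMul * W2 y.toMul := map_mul W2 _ _
      rw [h]; rfl)
  let o : A → E := fun x => Additive.ofMul (Abelianization.of x)
  have ho : Function.Surjective o := fun x => QuotientGroup.mk_surjective x.toMul
  have hω : ∀ x y, ω (o x) (o y) = Additive.ofMul (w x y) := fun x y => congrArg Additive.ofMul (hW2 x y)
  let F : AddSubgroup E := Subgroup.toAddSubgroup (B.map Abelianization.of)
  have hF : ∀ x ∈ F, ∃ b ∈ B, o b = x := fun x hx => hx
  have hF' : ∀ b ∈ B, o b ∈ F := fun b hb => ⟨b, hb, rfl⟩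
  have halt : ∀ x, ω x x = 0 := by
    intro x
    obtain ⟨x, rfl⟩ := ho x
    rw [hω, ← ofMul_one]
    congr 1
    have : (⟨⁅x, x⁆, Subgroup.commutator_mem_commutator (Subgroup.mem_top _) (Subgroup.mem_top _)⟩ : commutator A) = 1 :=
      Subtype.ext (commutatorElement_self x)
    simp only [w]
    rw [this, map_one]
  have hFF : ∀ x ∈ F, ∀ y ∈ F, ω x y = 0 := by
    intro x hx y hy
    obtain ⟨x, hxB, rfl⟩ := hF x hx
    obtain ⟨y, hyB, rfl⟩ := hF y hy
    rw [hω, ← ofMul_one]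
    congr 1
    apply hψB
    exact B.mul_mem (B.mul_mem (B.mul_mem hxB hyB) (B.inv_mem hxB)) (B.inv_mem hyB)
  have hpc : ∀ p : ℕ, p.Prime → ∃ g ∈ F, ∀ x ∈ F, ∃ i : ℤ, ∃ m ∈ F, x = i • g + (p : ℤ) • m := by
    intro p hp
    obtain ⟨g, hg, h⟩ := hcyc p hp
    refine ⟨o g, hF' g hg, fun x hx => ?_⟩
    obtain ⟨x, hxB, rfl⟩ := hF x hx
    obtain ⟨i, m, hm, c, hc, e⟩ := h x hxB
    refine ⟨i, o m, hF' m hm, ?_⟩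
    have hc1 : Abelianization.of c = 1 := by
      rw [← MonoidHom.mem_ker, Abelianization.ker_of]; exact hc
    have e' : Abelianization.of x = Abelianization.of g ^ i * Abelianization.of m ^ p := by
      rw [e, map_mul, map_mul, hc1, mul_one, map_zpow, map_pow]
    rw [natCast_zsmul]
    exact congrArg Additive.ofMul e'
  obtain ⟨b, b1, b2, b3, b4⟩ := global_beta F ω halt (q_kill F ω halt hFF (cyc_all F hpc))
  have hoo : ∀ x y, o (x * y) = o x + o y := fun x y => congrArg Additive.ofMul (map_mul Abelianization.of x y)
  refine ⟨MonoidHom.mk' (fun x => MonoidHom.mk' (fun y => (b (o x) (o y)).toMul) ?_) ?_, ?_, ?_⟩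
  · intro y z
    rw [hoo, b2]; rfl
  · intro x y
    ext1 z
    change (b (o (x * y)) (o z)).toMul = (b (o x) (o z)).toMul * (b (o y) (o z)).toMul
    rw [hoo, b1]; rfl
  · intro x hx
    ext1 z
    exact b4 (o x) (o z) (hF' x hx)
  · intro x y
    have := b3 (o x) (o y)
    rw [hω, sub_eq_iff_eq_add] at this
    exact this

theorem dom_le {A : Type u} [Group A] (hA : IsNil2 A) (B : Subgroup A)
    (hcyc : ∀ p : ℕ, p.Prime → ∃ g ∈ B, ∀ x ∈ B, ∃ i : ℤ, ∃ m ∈ B, ∃ c ∈ commutator A,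
      x = g ^ i * m ^ p * c) (a : A) (ha : a ∈ Dominion B) : a ∈ B := by
  -- first, `a` lies in `B` times the commutator subgroup
  obtain ⟨b, hb, c, hc⟩ : ∃ b ∈ B, ∃ c : commutator A, a = b * c := by
    let L : Subgroup (Abelianization A) := B.map Abelianization.of
    have := ha (Abelianization A ⧸ L) (by
      unfold IsNil2
      rw [commutator_def, Subgroup.commutator_le]
      intro p _ q _
      rw [commutatorElement_eq_one_iff_mul_comm.mpr (mul_comm p q)]
      exact Subgroup.one_mem _) ((QuotientGroup.mk' L).comp Abelianization.of) 1 (by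
      intro b hb
      exact (QuotientGroup.eq_one_iff _).mpr ⟨b, hb, rfl⟩)
    obtain ⟨b, hb, e⟩ := (QuotientGroup.eq_one_iff _).mp this
    refine ⟨b, hb, ⟨b⁻¹ * a, ?_⟩, by simp⟩
    rw [← Abelianization.ker_of, MonoidHom.mem_ker, map_mul, map_inv, e, inv_mul_cancel]
  have hcd : (c : A) ∈ Dominion B := by
    intro C _ hC f g hfg
    have h1 := ha C hC f g hfg
    rw [hc, map_mul, map_mul, hfg b hb] at h1
    exact mul_left_cancel h1
  suffices h : (c : A) ∈ B by rw [hc]; exact B.mul_mem hb h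
  by_contra hcB
  let _ : CommGroup (commutator A) :=
    { (inferInstance : Group (commutator A)) with
      mul_comm := fun x y => Subtype.ext (Subgroup.mem_center_iff.mp (hA y.2) x) }
  obtain ⟨ψ, hψ, hψc⟩ := circle_sep (B.subgroupOf (commutator A)) c hcB
  obtain ⟨β, hβB, hβψ⟩ := exists_beta hA B ψ hψ hcyc
  obtain ⟨φ, h1, h2, h3⟩ := exists_phi hA B β ψ hψ hβB hβψ
  exact hψc (by rw [← h3]; exact dom_phi hA B β φ h1 hβB h2 c hcd)

theorem cyc_G {G : Type u} [Group G] (p : ℕ)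
    (h : ∀ (N : Subgroup G) [N.Normal],
      N = Subgroup.closure ({x : G | ∃ g : G, g ^ p = x} ∪ (commutator G : Set G)) →
      IsCyclic (G ⧸ N)) :
    ∃ g : G, ∀ x : G, ∃ i : ℤ, ∃ m : G, ∃ c ∈ commutator G, x = g ^ i * m ^ p * c := by
  let N := Subgroup.closure ({x : G | ∃ g : G, g ^ p = x} ∪ (commutator G : Set G))
  have hcN : commutator G ≤ N := fun x hx => Subgroup.subset_closure (Or.inr hx)
  have : N.Normal := ⟨fun n hn g => by
    have : ⁅g, n⁆ * n ∈ N :=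
      N.mul_mem (hcN (Subgroup.commutator_mem_commutator (Subgroup.mem_top _) (Subgroup.mem_top _))) hn
    simpa [commutatorElement_def] using this⟩
  obtain ⟨g, hg⟩ := (h N rfl).exists_generator
  obtain ⟨g, rfl⟩ := QuotientGroup.mk_surjective g
  have hN : ∀ x ∈ N, ∃ m : G, Abelianization.of x = Abelianization.of m ^ p := by
    intro x hx
    induction hx using Subgroup.closure_induction with
    | mem x hx =>
      rcases hx with ⟨m, rfl⟩ | hx
      · exact ⟨m, map_pow _ _ _⟩
      · refine ⟨1, ?_⟩
        rw [map_one, one_pow, ← MonoidHom.mem_ker, Abelianization.ker_of]; exact hx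
    | one => exact ⟨1, by simp⟩
    | mul x y _ _ hx hy =>
      obtain ⟨m, hm⟩ := hx
      obtain ⟨n, hn⟩ := hy
      exact ⟨m * n, by rw [map_mul, map_mul, hm, hn, mul_pow]⟩
    | inv x _ hx =>
      obtain ⟨m, hm⟩ := hx
      exact ⟨m⁻¹, by rw [map_inv, map_inv, hm, inv_pow]⟩
  refine ⟨g, fun x => ?_⟩
  obtain ⟨i, hi⟩ := Subgroup.mem_zpowers_iff.mp (hg (QuotientGroup.mk x))
  have hi' : (g ^ i)⁻¹ * x ∈ N := QuotientGroup.eq.mp hi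
  obtain ⟨m, hm⟩ := hN _ hi'
  refine ⟨i, m, (g ^ i * m ^ p)⁻¹ * x, ?_, (mul_inv_cancel_left _ _).symm⟩
  rw [← Abelianization.ker_of, MonoidHom.mem_ker, mul_inv_rev, mul_assoc, map_mul, hm, map_inv,
    map_pow, inv_mul_cancel]

/-- If for every prime `p` the quotient of a nil-2 group `G` by the subgroup generated
by all `p`-th powers together with `[G,G]` is cyclic, then `G` is absolutely closed
in `N₂`. -/
theorem absolutelyClosed_of_quotients_cyclic {G : Type u} [Group G] (hG : IsNil2 G)
    (h : ∀ p : ℕ, p.Prime → ∀ (N : Subgroup G) [N.Normal],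
      N = Subgroup.closure ({x : G | ∃ g : G, g ^ p = x} ∪ (commutator G : Set G)) →
      IsCyclic (G ⧸ N)) :
    IsAbsolutelyClosed G := by
  intro A _ hA ι hι
  apply Set.Subset.antisymm
  · intro a ha
    refine dom_le hA ι.range ?_ a ha
    intro p hp
    obtain ⟨g, hg⟩ := cyc_G p (h p hp)
    refine ⟨ι g, ⟨g, rfl⟩, ?_⟩
    rintro _ ⟨x, rfl⟩
    obtain ⟨i, m, c, hc, e⟩ := hg x
    refine ⟨i, ι m, ⟨m, rfl⟩, ι c, ?_, by rw [e]; simp⟩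
    have : (commutator G).map ι ≤ commutator A := by
      rw [commutator_def, Subgroup.map_commutator]
      exact Subgroup.commutator_mono le_top le_top
    exact this ⟨c, hc, rfl⟩
  · intro a ha C _ hC f g hfg
    exact hfg a ha
end
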